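/- arXiv:2305.01472 — 2 statements merged into one kernel-verified Lean document; each statement's English description precedes it below -/
import Mathlib

section
/- For every positive integer ω, there is a function f_ω : ℕ × ℕ → ℝ satisfying the following. Let Γ be an abelian group, let A ⊆ Γ be a non-empty set with |Γ \ A| ≤ ω, and let (G, γ) be a Γ-labelled graph. If arb_{(Γ,A)}(G, γ) ≥ f_ω(t, d), then G contains an (A, d)-subdivision of K_t. -/
namespace ArbPaper

universe u v

/-- The `γ`-value of a walk: the sum of the labels of its edges. -/
def walkVal {V : Type u} {Γ : Type v} [AddCommGroup Γ] {G : SimpleGraph V}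
    (γ : Sym2 V → Γ) {x y : V} (w : G.Walk x y) : Γ :=
  (w.edges.map γ).sum

/-- The set `S` induces a subgraph having no cycle of `γ`-value in `A`. -/
def NoCycleValIn {V : Type u} {Γ : Type v} [AddCommGroup Γ] (G : SimpleGraph V)
    (γ : Sym2 V → Γ) (A : Set Γ) (S : Set V) : Prop :=
  ∀ (v : V) (w : G.Walk v v), w.IsCycle → (∀ x ∈ w.support, x ∈ S) →
    walkVal γ w ∉ A

/-- The `(Γ, A)`-vertex-arboricity of the subgraph of `G` induced on `S`:
the minimum number of parts in a partition of `S` such that each part induces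
a subgraph having no cycle of `γ`-value in `A`. -/
noncomputable def arbOn {V : Type u} {Γ : Type v} [AddCommGroup Γ] (G : SimpleGraph V)
    (γ : Sym2 V → Γ) (A : Set Γ) (S : Set V) : ℕ :=
  sInf {k : ℕ | ∃ f : V → Fin k,
    ∀ i : Fin k, NoCycleValIn G γ A {v | v ∈ S ∧ f v = i}}

/-- The `(Γ, A)`-vertex-arboricity of `(G, γ)`. -/
noncomputable def arb {V : Type u} {Γ : Type v} [AddCommGroup Γ] (G : SimpleGraph V)
    (γ : Sym2 V → Γ) (A : Set Γ) : ℕ :=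
  arbOn G γ A Set.univ

/-- `G` contains an `(A, d)`-cycle: a cycle of `γ`-value in `A` and length at least `d`. -/
def ContainsADCycle {V : Type u} {Γ : Type v} [AddCommGroup Γ] (G : SimpleGraph V)
    (γ : Sym2 V → Γ) (A : Set Γ) (d : ℕ) : Prop :=
  ∃ (v : V) (w : G.Walk v v), w.IsCycle ∧ walkVal γ w ∈ A ∧ d ≤ w.length

/-- `b` (the branching vertices) together with the branching paths `P i j` (for `i < j`)
form a subdivision of the complete graph `K t` inside `G`. -/
def IsKtSubdivision {V : Type u} (G : SimpleGraph V) (t : ℕ) (b : Fin t → V)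
    (P : ∀ i j : Fin t, G.Walk (b i) (b j)) : Prop :=
  Function.Injective b ∧
  (∀ i j : Fin t, i < j → (P i j).IsPath) ∧
  (∀ i j : Fin t, i < j → ∀ v ∈ (P i j).support, v ∈ Set.range b → v = b i ∨ v = b j) ∧
  (∀ i j k l : Fin t, i < j → k < l → (i, j) ≠ (k, l) → ∀ v,
    v ∈ (P i j).support → v ∈ (P k l).support →
      (v = b i ∨ v = b j) ∧ (v = b k ∨ v = b l))

/-- `G` itself is (as a whole) a subdivision of `K t` with data `b`, `P`:
every vertex and every edge of `G` lies on some branching path. -/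
def IsSpanningKtSubdivision {V : Type u} (G : SimpleGraph V) (t : ℕ) (b : Fin t → V)
    (P : ∀ i j : Fin t, G.Walk (b i) (b j)) : Prop :=
  IsKtSubdivision G t b P ∧
  (∀ v : V, ∃ i j : Fin t, i < j ∧ v ∈ (P i j).support) ∧
  (∀ e ∈ G.edgeSet, ∃ i j : Fin t, i < j ∧ e ∈ (P i j).edges)

/-- `G` contains an `(A, d)`-subdivision of `K t`: a subdivision of `K t` in which every
branching path has `γ`-value in `A` and length at least `d`. -/
def ContainsADSubdivision {V : Type u} {Γ : Type v} [AddCommGroup Γ] (G : SimpleGraph V)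
    (γ : Sym2 V → Γ) (A : Set Γ) (t d : ℕ) : Prop :=
  ∃ (b : Fin t → V) (P : ∀ i j : Fin t, G.Walk (b i) (b j)),
    IsKtSubdivision G t b P ∧
    ∀ i j : Fin t, i < j → walkVal γ (P i j) ∈ A ∧ d ≤ (P i j).length

/-- `w` is an `X`-path lying inside the induced subgraph `G[Y]`: a path of length at
least `2` whose endpoints lie in `X`, internal vertices lie outside `X`, and all of
whose vertices lie in `Y`. -/
def IsXPathIn {V : Type u} (G : SimpleGraph V) (X Y : Set V) {x y : V}
    (w : G.Walk x y) : Prop :=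
  w.IsPath ∧ 2 ≤ w.length ∧ x ∈ X ∧ y ∈ X ∧
  (∀ v ∈ w.support, v ∈ Y) ∧
  (∀ v ∈ w.support, v ≠ x → v ≠ y → v ∉ X)

/-- `(L 0, L 1, …, L p)` is a leveling of the connected graph `G`. -/
def IsLeveling {V : Type u} (G : SimpleGraph V) (p : ℕ) (L : ℕ → Set V) : Prop :=
  (∀ i j, i ≤ p → j ≤ p → i ≠ j → Disjoint (L i) (L j)) ∧
  (∃ v : V, L 0 = {v}) ∧
  (∀ v : V, ∃ i, i ≤ p ∧ v ∈ L i) ∧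
  (∀ i, 1 ≤ i → i ≤ p → ∀ v ∈ L i,
    (∃ u ∈ L (i - 1), G.Adj v u) ∧ (∀ j, j + 2 ≤ i → ∀ u ∈ L j, ¬ G.Adj v u))

/-- `G[Y]` is a connected component of `G[S]`. -/
def IsCompOf {V : Type u} (G : SimpleGraph V) (Y S : Set V) : Prop :=
  Y ⊆ S ∧ (G.induce Y).Connected ∧ ∀ u ∈ Y, ∀ v ∈ S, G.Adj u v → v ∈ Y


/-- Values `g` of paths `u → v` inside `W` of length at least `l`. -/
def PV {V : Type u} {Γ : Type v} [AddCommGroup Γ] (G : SimpleGraph V)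
    (γ : Sym2 V → Γ) (W : Set V) (l : ℕ) (a b : V) (g : Γ) : Prop :=
  ∃ p : G.Walk a b, p.IsPath ∧ (∀ x ∈ p.support, x ∈ W) ∧ walkVal γ p = g ∧ l ≤ p.length

section basics
variable {V : Type u} {Γ : Type v} [AddCommGroup Γ] {G : SimpleGraph V} {γ : Sym2 V → Γ}

lemma walkVal_append {a b c : V} (p : G.Walk a b) (q : G.Walk b c) :
    walkVal γ (p.append q) = walkVal γ p + walkVal γ q := by
  simp [walkVal, SimpleGraph.Walk.edges_append]

lemma walkVal_reverse {a b : V} (p : G.Walk a b) :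
    walkVal γ p.reverse = walkVal γ p := by
  simp [walkVal, SimpleGraph.Walk.edges_reverse, List.sum_reverse]

lemma PV.mono {W W' : Set V} {l l' : ℕ} {a b : V} {g : Γ} (h : PV G γ W l a b g)
    (hW : W ⊆ W') (hl : l' ≤ l) : PV G γ W' l' a b g := by
  obtain ⟨p, h1, h2, h3, h4⟩ := h
  exact ⟨p, h1, fun x hx => hW (h2 x hx), h3, hl.trans h4⟩

lemma PV.symm {W : Set V} {l : ℕ} {a b : V} {g : Γ} (h : PV G γ W l a b g) :
    PV G γ W l b a g := by
  obtain ⟨p, h1, h2, h3, h4⟩ := h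
  refine ⟨p.reverse, h1.reverse, fun x hx => h2 x (by simpa using hx), ?_, by simpa using h4⟩
  rw [walkVal_reverse, h3]

lemma PV.nil {W : Set V} {a : V} (h : a ∈ W) : PV G γ W 0 a a 0 := by
  refine ⟨SimpleGraph.Walk.nil, by simp, by simpa using h, by simp [walkVal], by simp⟩

lemma PV.join {W₁ W₂ : Set V} {l₁ l₂ : ℕ} {a b c : V} {g₁ g₂ : Γ}
    (h₁ : PV G γ W₁ l₁ a b g₁) (h₂ : PV G γ W₂ l₂ b c g₂)
    (h : ∀ x ∈ W₁, x ∈ W₂ → x = b) : PV G γ (W₁ ∪ W₂) (l₁ + l₂) a c (g₁ + g₂) := by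
  obtain ⟨p, hp1, hp2, hp3, hp4⟩ := h₁
  obtain ⟨q, hq1, hq2, hq3, hq4⟩ := h₂
  refine ⟨p.append q, ?_, ?_, by rw [walkVal_append, hp3, hq3], ?_⟩
  · rw [SimpleGraph.Walk.isPath_def, SimpleGraph.Walk.support_append, List.nodup_append']
    refine ⟨hp1.support_nodup, hq1.support_nodup.tail, ?_⟩
    intro x hx hx'
    have hxb := h x (hp2 x hx) (hq2 x (List.mem_of_mem_tail hx'))
    subst hxb
    have := hq1.support_nodup
    rw [← SimpleGraph.Walk.cons_tail_support] at this
    exact (List.nodup_cons.1 this).1 hx'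
  · intro x hx
    rw [SimpleGraph.Walk.mem_support_append_iff] at hx
    rcases hx with hx | hx
    · exact Or.inl (hp2 x hx)
    · exact Or.inr (hq2 x hx)
  · rw [SimpleGraph.Walk.length_append]; omega

/-- assembling a subdivision -/
lemma assemble {A : Set Γ} {t d : ℕ} (b : Fin t → V) (hb : Function.Injective b)
    (W : Fin t → Fin t → Set V) (hbW : ∀ i j k, b k ∉ W i j)
    (hW : ∀ i j k l, (i, j) ≠ (k, l) → Disjoint (W i j) (W k l))
    (h : ∀ i j, i < j → ∃ g ∈ A, PV G γ ({b i, b j} ∪ W i j) d (b i) (b j) g) :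
    ContainsADSubdivision G γ A t d := by
  have h' : ∀ i j, ∃ p : G.Walk (b i) (b j), i < j → (p.IsPath ∧
      (∀ x ∈ p.support, x ∈ {b i, b j} ∪ W i j) ∧ walkVal γ p ∈ A ∧ d ≤ p.length) := by
    intro i j
    rcases lt_trichotomy i j with hij | rfl | hij
    · obtain ⟨g, hg, p, h1, h2, h3, h4⟩ := h i j hij
      exact ⟨p, fun _ => ⟨h1, h2, h3 ▸ hg, h4⟩⟩
    · exact ⟨SimpleGraph.Walk.nil, fun h => absurd h (lt_irrefl _)⟩
    · obtain ⟨g, hg, p, h1, h2, h3, h4⟩ := h j i hij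
      exact ⟨p.reverse, fun h => absurd h (not_lt.2 hij.le)⟩
  choose P hP using h'
  refine ⟨b, P, ⟨hb, fun i j hij => (hP i j hij).1, ?_, ?_⟩, fun i j hij => (hP i j hij).2.2⟩
  · rintro i j hij x hx ⟨k, rfl⟩
    rcases (hP i j hij).2.1 _ hx with h | h
    · simpa using h
    · exact absurd h (hbW i j k)
  · intro i j k l hij hkl hne x hx hx'
    rcases (hP i j hij).2.1 _ hx with h | h <;> rcases (hP k l hkl).2.1 _ hx' with h' | h'
    · exact ⟨by simpa using h, by simpa using h'⟩
    · rcases h with h | h <;> exact absurd (h ▸ h') (hbW k l _)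
    · rcases h' with h' | h' <;> exact absurd (h' ▸ h) (hbW i j _)
    · exact absurd h' (Set.disjoint_left.1 (hW i j k l hne) h)

end basics

/-- A family of disjoint units: each consists of a connector and an `A`-cycle. -/
structure Units {V : Type u} {Γ : Type v} [AddCommGroup Γ] (G : SimpleGraph V)
    (γ : Sym2 V → Γ) (A : Set Γ) (ι : Type) where
  Y : Set V
  T : ι → Set V
  C : ι → Set V
  hCY : ∀ j, C j ⊆ Y
  hC : ∀ i j, i ≠ j → Disjoint (C i) (C j)
  hT : ∀ i j, i ≠ j → Disjoint (T i) (T j)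
  hTY : ∀ j, Disjoint (T j) Y
  conn : ∀ j, ∀ a ∈ Y, ∀ b ∈ Y, a ≠ b → ∃ g, PV G γ ({a, b} ∪ T j) 1 a b g
  cyc : ∀ j, ∃ x ∈ C j, ∃ y ∈ C j, x ≠ y ∧ ∃ g g', PV G γ (C j) 0 x y g ∧
    PV G γ (C j) 0 x y g' ∧ g + g' ∈ A

namespace Units
variable {V : Type u} {Γ : Type v} [AddCommGroup Γ] {G : SimpleGraph V} {γ : Sym2 V → Γ}
  {A : Set Γ} {ι : Type} (U : Units G γ A ι)

/-- vertices of a region -/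
def W (J : Finset ι) : Set V := {x | ∃ j ∈ J, x ∈ U.T j ∨ x ∈ U.C j}

/-- hub vertices of a region -/
def Hub (J : Finset ι) : Set V := {x | ∃ j ∈ J, x ∈ U.C j}

lemma W_mono {J J' : Finset ι} (h : J ⊆ J') : U.W J ⊆ U.W J' := by
  rintro x ⟨j, hj, hx⟩; exact ⟨j, h hj, hx⟩

lemma Hub_mono {J J' : Finset ι} (h : J ⊆ J') : U.Hub J ⊆ U.Hub J' := by
  rintro x ⟨j, hj, hx⟩; exact ⟨j, h hj, hx⟩

lemma Hub_sub_W (J : Finset ι) : U.Hub J ⊆ U.W J := by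
  rintro x ⟨j, hj, hx⟩; exact ⟨j, hj, Or.inr hx⟩

lemma Hub_sub_Y (J : Finset ι) : U.Hub J ⊆ U.Y := by
  rintro x ⟨j, hj, hx⟩; exact U.hCY j hx

lemma T_sub_W {J : Finset ι} {k : ι} (h : k ∈ J) : U.T k ⊆ U.W J := by
  intro x hx; exact ⟨k, h, Or.inl hx⟩

lemma C_sub_W {J : Finset ι} {k : ι} (h : k ∈ J) : U.C k ⊆ U.W J := by
  intro x hx; exact ⟨k, h, Or.inr hx⟩

lemma TC (j k : ι) : Disjoint (U.T j) (U.C k) := (U.hTY j).mono_right (U.hCY k)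

lemma W_disj {J J' : Finset ι} (h : Disjoint J J') : Disjoint (U.W J) (U.W J') := by
  rw [Set.disjoint_left]
  rintro x ⟨j, hj, hx⟩ ⟨k, hk, hx'⟩
  have hne : j ≠ k := by rintro rfl; exact Finset.disjoint_left.1 h hj hk
  rcases hx with hx | hx <;> rcases hx' with hx' | hx'
  · exact Set.disjoint_left.1 (U.hT j k hne) hx hx'
  · exact Set.disjoint_left.1 (U.TC j k) hx hx'
  · exact Set.disjoint_left.1 (U.TC k j) hx' hx
  · exact Set.disjoint_left.1 (U.hC j k hne) hx hx'

lemma T_disj_W {J : Finset ι} {k : ι} (h : k ∉ J) : Disjoint (U.T k) (U.W J) := by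
  have := U.W_disj (J := {k}) (J' := J) (by simpa using h)
  exact this.mono_left (U.T_sub_W (by simp))

lemma join3 {W₁ W₂ : Set V} {k : ι} {v v' : V} (h12 : Disjoint W₁ W₂)
    (h1 : Disjoint (U.T k) W₁) (h2 : Disjoint (U.T k) W₂)
    (hv : v ∈ W₁) (hv' : v' ∈ W₂) (hvY : v ∈ U.Y) (hvY' : v' ∈ U.Y) :
    ∃ τ : Γ, ∀ a b l₁ l₂ g₁ g₂, PV G γ W₁ l₁ a v g₁ → PV G γ W₂ l₂ v' b g₂ →
      PV G γ (W₁ ∪ U.T k ∪ W₂) (l₁ + 1 + l₂) a b (g₁ + τ + g₂) := by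
  have hne : v ≠ v' := by rintro rfl; exact Set.disjoint_left.1 h12 hv hv'
  obtain ⟨τ, hτ⟩ := U.conn k v hvY v' hvY' hne
  refine ⟨τ, fun a b l₁ l₂ g₁ g₂ p q => ?_⟩
  rw [Set.disjoint_left] at h12 h1 h2
  have e1 := p.join hτ (by
    rintro x hx ((rfl | hx') | hx')
    · rfl
    · cases hx'; exact absurd hv' (h12 hx)
    · exact absurd hx (h1 hx'))
  have e2 := e1.join q (by
    rintro x (hx | (rfl | hx) | hx) hx'
    · exact absurd hx' (h12 hx)
    · exact absurd hx' (h12 hv)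
    · exact hx
    · exact absurd hx' (h2 hx))
  refine e2.mono ?_ le_rfl
  rintro x ((hx | (rfl | hx) | hx) | hx)
  · exact Or.inl (Or.inl hx)
  · exact Or.inl (Or.inl hv)
  · cases hx; exact Or.inr hv'
  · exact Or.inl (Or.inr hx)
  · exact Or.inr hx

/-- The region is single-valued modulo `H`. -/
def Single (J : Finset ι) (H : AddSubgroup Γ) : Prop :=
  ∀ a ∈ U.Hub J, ∀ b ∈ U.Hub J, ∀ g g', PV G γ (U.W J) 0 a b g → PV G γ (U.W J) 0 a b g' →
    g - g' ∈ H

lemma Single.mono {U : Units G γ A ι} {J J' : Finset ι} {H : AddSubgroup Γ} (h : U.Single J H) (hJ : J' ⊆ J) :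
    U.Single J' H := fun a ha b hb g g' hg hg' =>
  h a (U.Hub_mono hJ ha) b (U.Hub_mono hJ hb) g g' (hg.mono (U.W_mono hJ) le_rfl)
    (hg'.mono (U.W_mono hJ) le_rfl)

lemma hub_exists {J : Finset ι} (h : J.Nonempty) : ∃ a, a ∈ U.Hub J := by
  obtain ⟨j, hj⟩ := h
  obtain ⟨x, hx, -⟩ := U.cyc j
  exact ⟨x, j, hj, hx⟩

/-- connectors inside a region -/
lemma conn_in {J : Finset ι} {k : ι} (hk : k ∈ J) {a b : V} (ha : a ∈ U.Hub J)
    (hb : b ∈ U.Hub J) (hab : a ≠ b) :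
    ∃ g, PV G γ ({a, b} ∪ U.T k) 1 a b g ∧ PV G γ (U.W J) 0 a b g := by
  obtain ⟨g, hg⟩ := U.conn k a (U.Hub_sub_Y J ha) b (U.Hub_sub_Y J hb) hab
  refine ⟨g, hg, hg.mono ?_ (by simp)⟩
  rintro x ((rfl | hx) | hx)
  · exact U.Hub_sub_W J ha
  · cases hx; exact U.Hub_sub_W J hb
  · exact U.T_sub_W hk hx

lemma Single.add {U : Units G γ A ι} {J : Finset ι} {H : AddSubgroup Γ} (h : U.Single J H)
    (hJ : 2 ≤ J.card) {a b c : V} (ha : a ∈ U.Hub J) (hb : b ∈ U.Hub J) (hc : c ∈ U.Hub J)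
    (hab : a ≠ b) (hbc : b ≠ c) (hac : a ≠ c) {α β δ : Γ} (hα : PV G γ (U.W J) 0 a b α)
    (hβ : PV G γ (U.W J) 0 b c β) (hδ : PV G γ (U.W J) 0 a c δ) : α + β - δ ∈ H := by
  obtain ⟨k, hk, k', hk', hkk⟩ := Finset.one_lt_card.1 (show 1 < J.card by omega)
  obtain ⟨τ, h1, h1'⟩ := U.conn_in hk ha hb hab
  obtain ⟨τ', h2, h2'⟩ := U.conn_in hk' hb hc hbc
  have hY := U.Hub_sub_Y J
  have e := h1.join h2 (by
    have d1 := Set.disjoint_left.1 (U.hTY k)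
    have d2 := Set.disjoint_left.1 (U.hTY k')
    have d3 := Set.disjoint_left.1 (U.hT k k' hkk)
    rintro x ((rfl | hx) | hx) ((rfl | hx') | hx')
    · rfl
    · exact absurd hx' hac
    · exact absurd (hY ha) (d2 hx')
    · rfl
    · exact hx
    · exact hx
    · rfl
    · cases hx'; exact absurd (hY hc) (d1 hx)
    · exact absurd hx' (d3 hx))
  have e' : PV G γ (U.W J) 0 a c (τ + τ') := by
    refine e.mono ?_ (by simp)
    rintro x (((rfl | hx) | hx) | ((rfl | hx') | hx'))
    · exact U.Hub_sub_W J ha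
    · cases hx; exact U.Hub_sub_W J hb
    · exact U.T_sub_W hk hx
    · exact U.Hub_sub_W J hb
    · cases hx'; exact U.Hub_sub_W J hc
    · exact U.T_sub_W hk' hx'
  have q1 := h a ha b hb _ _ hα h1'
  have q2 := h b hb c hc _ _ hβ h2'
  have q3 := h a ha c hc _ _ e' hδ
  have := H.add_mem (H.add_mem q1 q2) q3
  convert this using 1
  abel

lemma exists_third {J : Finset ι} (hJ : 3 ≤ J.card) (b c : V) :
    ∃ a ∈ U.Hub J, a ≠ b ∧ a ≠ c := by
  choose x hx _ using U.cyc
  have hinj : ∀ i j, x i = x j → i = j := by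
    intro i j hij
    by_contra hne
    exact Set.disjoint_left.1 (U.hC i j hne) (hx i) (hij ▸ hx j)
  classical
  have hc : 2 < (J.image x).card := by
    rw [Finset.card_image_of_injective _ (fun i j h => hinj i j h)]; omega
  obtain ⟨a, ha, ha'⟩ := Finset.exists_mem_notMem_of_card_lt_card
    (show ({b, c} : Finset V).card < (J.image x).card from
      lt_of_le_of_lt (Finset.card_le_two) hc)
  obtain ⟨j, hj, rfl⟩ := Finset.mem_image.1 ha
  simp only [Finset.mem_insert, Finset.mem_singleton, not_or] at ha'
  exact ⟨x j, ⟨j, hj, hx j⟩, ha'.1, ha'.2⟩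

lemma Single.two {U : Units G γ A ι} {J : Finset ι} {H : AddSubgroup Γ} (h : U.Single J H)
    (hJ : 3 ≤ J.card) {b c : V} (hb : b ∈ U.Hub J) (hc : c ∈ U.Hub J)
    (hbc : b ≠ c) {β : Γ} (hβ : PV G γ (U.W J) 0 b c β) : β + β ∈ H := by
  obtain ⟨a, ha, hab, hac⟩ := U.exists_third hJ b c
  obtain ⟨k, hk⟩ := Finset.card_pos.1 (show 0 < J.card by omega)
  obtain ⟨α, -, hα⟩ := U.conn_in hk ha hb hab
  obtain ⟨δ, -, hδ⟩ := U.conn_in hk ha hc hac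
  have q1 := h.add (by omega) ha hb hc hab hbc hac hα hβ hδ
  have q2 := h.add (by omega) ha hc hb hac hbc.symm hab hδ hβ.symm hα
  have := H.add_mem q1 q2
  convert this using 1
  abel

lemma Single.cyc_mem {U : Units G γ A ι} {J : Finset ι} {H : AddSubgroup Γ} (h : U.Single J H)
    (hJ : 3 ≤ J.card) : ∃ c ∈ A, c ∈ H := by
  obtain ⟨k, hk⟩ := Finset.card_pos.1 (show 0 < J.card by omega)
  obtain ⟨x, hx, y, hy, hxy, g, g', hg, hg', hA⟩ := U.cyc k
  have hg := hg.mono (U.C_sub_W hk) le_rfl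
  have hg' := hg'.mono (U.C_sub_W hk) le_rfl
  have q1 := h x ⟨k, hk, hx⟩ y ⟨k, hk, hy⟩ g' g hg' hg
  have q2 := h.two hJ ⟨k, hk, hx⟩ ⟨k, hk, hy⟩ hxy hg
  refine ⟨_, hA, ?_⟩
  have := H.add_mem q1 q2
  convert this using 1
  abel

end Units

/-- translation stabilizer of a finite set -/
def stab {Γ : Type v} [AddCommGroup Γ] (X : Finset Γ) : AddSubgroup Γ where
  carrier := {s | ∀ x, x + s ∈ X ↔ x ∈ X}
  zero_mem' := by intro x; simp
  add_mem' := by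
    intro a b ha hb x
    rw [← add_assoc, hb, ha]
  neg_mem' := by
    intro a ha x
    rw [← ha (x + -a)]; simp

lemma stab_finite {Γ : Type v} [AddCommGroup Γ] (X : Finset Γ) (hX : X.Nonempty) :
    Finite (stab X) ∧ Nat.card (stab X) ≤ X.card := by
  obtain ⟨x, hx⟩ := hX
  let F : stab X → X := fun s => ⟨x + s.1, (s.2 x).2 hx⟩
  have hF : Function.Injective F := by
    intro s s' h
    have := congrArg Subtype.val h
    exact Subtype.ext (add_left_cancel this)
  refine ⟨Finite.of_injective F hF, ?_⟩
  have := Nat.card_le_card_of_injective F hF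
  simpa using this

lemma grow {Γ : Type v} [AddCommGroup Γ] [DecidableEq Γ] (X : Finset Γ) (g g' : Γ)
    (h : g - g' ∉ stab X) : X.card + 1 ≤ (X.image (· + g) ∪ X.image (· + g')).card := by
  by_contra hlt
  apply h
  have c1 : (X.image (· + g)).card = X.card :=
    Finset.card_image_of_injective _ (add_left_injective g)
  have c2 : (X.image (· + g')).card = X.card :=
    Finset.card_image_of_injective _ (add_left_injective g')
  have e1 := Finset.eq_of_subset_of_card_le
    (Finset.subset_union_left (s₁ := X.image (· + g)) (s₂ := X.image (· + g'))) (by omega)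
  have e2 := Finset.eq_of_subset_of_card_le
    (Finset.subset_union_right (s₁ := X.image (· + g)) (s₂ := X.image (· + g'))) (by omega)
  have e : X.image (· + g) = X.image (· + g') := e1.trans e2.symm
  intro x
  constructor
  · intro hx
    have : (x + (g - g')) + g' ∈ X.image (· + g) := by
      rw [e]; exact Finset.mem_image_of_mem _ hx
    obtain ⟨y, hy, hy'⟩ := Finset.mem_image.1 this
    have : y = x := by
      have h2 : y + g = x + g := by rw [hy']; abel
      exact add_right_cancel h2
    exact this ▸ hy
  · intro hx
    have : x + g ∈ X.image (· + g') := by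
      rw [← e]; exact Finset.mem_image_of_mem (· + g) hx
    obtain ⟨y, hy, hy'⟩ := Finset.mem_image.1 this
    have : y = x + (g - g') := by
      have h2 : y + g' = x + (g - g') + g' := by rw [hy']; abel
      exact add_right_cancel h2
    exact this ▸ hy

namespace Units
variable {V : Type u} {Γ : Type v} [AddCommGroup Γ] {G : SimpleGraph V} {γ : Sym2 V → Γ}
  {A : Set Γ} {ι : Type} (U : Units G γ A ι)

lemma long [DecidableEq ι] : ∀ (l : ℕ) (J : Finset ι), J.card = l + 1 → ∃ a ∈ U.Hub J, ∃ b ∈ U.Hub J,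
    ∃ g, PV G γ (U.W J) l a b g := by
  intro l
  induction l with
  | zero =>
    intro J hJ
    obtain ⟨a, ha⟩ := U.hub_exists (J := J) (Finset.card_pos.1 (by omega))
    exact ⟨a, ha, a, ha, 0, PV.nil (U.Hub_sub_W J ha)⟩
  | succ l ih =>
    intro J hJ
    obtain ⟨k, hk⟩ := Finset.card_pos.1 (show 0 < J.card by omega)
    obtain ⟨a, ha, b, hb, g, hg⟩ := ih (J.erase k) (by rw [Finset.card_erase_of_mem hk]; omega)
    obtain ⟨x, hx, -⟩ := U.cyc k
    have hsub := Finset.erase_subset k J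
    have hxW : x ∉ U.W (J.erase k) := by
      have := U.W_disj (J := {k}) (J' := J.erase k) (by simp)
      exact Set.disjoint_left.1 this (U.C_sub_W (by simp) hx)
    obtain ⟨τ, hτ⟩ := U.join3 (W₁ := U.W (J.erase k)) (W₂ := {x}) (k := k) (v := b) (v' := x)
      (by simpa using hxW) (U.T_disj_W (by simp))
      ((U.TC k k).mono_right (by simpa using hx)) (U.Hub_sub_W _ hb) rfl (U.Hub_sub_Y _ hb)
      (U.hCY k hx)
    refine ⟨a, U.Hub_mono hsub ha, x, ⟨k, hk, hx⟩, _,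
      (hτ a x l 0 g 0 hg (PV.nil rfl)).mono ?_ le_rfl⟩
    rintro y ((hy | hy) | hy)
    · exact U.W_mono hsub hy
    · exact U.T_sub_W hk hy
    · cases hy; exact U.C_sub_W hk hx

lemma accumulate [DecidableEq ι] [DecidableEq Γ] {H : AddSubgroup Γ} {n ω : ℕ} :
    ∀ (a : ℕ), a ≤ ω → ∀ (J : Finset ι), a * (n + 1) + 1 ≤ J.card →
    (∃ J' ⊆ J, n ≤ J'.card ∧ ∃ S : AddSubgroup Γ, Finite S ∧ Nat.card S ≤ ω ∧ ¬ H ≤ S ∧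
      U.Single J' S) ∨
    (∃ a' ∈ U.Hub J, ∃ b ∈ U.Hub J, ∃ X : Finset Γ, X.Nonempty ∧
      (∀ x ∈ X, PV G γ (U.W J) 0 a' b x) ∧
      ((∀ x ∈ X, ∀ h ∈ H, x + h ∈ X) ∨ a + 1 ≤ X.card)) := by
  intro a
  induction a with
  | zero =>
    intro _ J hJ
    right
    obtain ⟨a, ha⟩ := U.hub_exists (J := J) (Finset.card_pos.1 (by omega))
    refine ⟨a, ha, a, ha, {0}, by simp, ?_, Or.inr (by simp)⟩
    intro x hx
    rw [Finset.mem_singleton.1 hx]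
    exact PV.nil (U.Hub_sub_W J ha)
  | succ a ih =>
    intro haω J hJ
    obtain ⟨K, hKJ, hK⟩ := Finset.exists_subset_card_eq (s := J) (n := n + 1)
      (by nlinarith)
    obtain ⟨k, hk⟩ := Finset.card_pos.1 (show 0 < K.card by omega)
    have hcK : (K.erase k).card = n := by rw [Finset.card_erase_of_mem hk]; omega
    have hKJ' : K.erase k ⊆ J := (Finset.erase_subset _ _).trans hKJ
    have hcJ : a * (n + 1) + 1 ≤ (J \ K).card := by
      rw [Finset.card_sdiff_of_subset hKJ, hK]
      have : (a + 1) * (n + 1) = a * (n + 1) + (n + 1) := by ring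
      omega
    have hJK : J \ K ⊆ J := Finset.sdiff_subset
    rcases ih (by omega) (J \ K) hcJ with ⟨J', h1, h2⟩ | ⟨p, hp, q, hq, X, hX, hXP, hX'⟩
    · exact Or.inl ⟨J', h1.trans hJK, h2⟩
    · have mono : ∀ x ∈ X, PV G γ (U.W J) 0 p q x := fun x hx =>
        (hXP x hx).mono (U.W_mono hJK) le_rfl
      rcases hX' with hX' | hX'
      · exact Or.inr ⟨p, U.Hub_mono hJK hp, q, U.Hub_mono hJK hq, X, hX, mono, Or.inl hX'⟩
      by_cases hbig : a + 2 ≤ X.card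
      · exact Or.inr ⟨p, U.Hub_mono hJK hp, q, U.Hub_mono hJK hq, X, hX, mono, Or.inr hbig⟩
      obtain ⟨hf, hc⟩ := stab_finite X hX
      by_cases hS : U.Single (K.erase k) (stab X)
      · by_cases hH : H ≤ stab X
        · exact Or.inr ⟨p, U.Hub_mono hJK hp, q, U.Hub_mono hJK hq, X, hX, mono,
            Or.inl fun x hx h hh => (hH hh x).2 hx⟩
        · exact Or.inl ⟨K.erase k, hKJ', hcK.ge, stab X, hf, by omega, hH, hS⟩
      · right
        unfold Single at hS
        push Not at hS
        obtain ⟨r, hr, s, hs, g, g', hg, hg', hgg⟩ := hS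
        obtain ⟨τ, hτ⟩ := U.join3 (W₁ := U.W (J \ K)) (W₂ := U.W (K.erase k)) (k := k)
          (v := q) (v' := r)
          (U.W_disj (Finset.sdiff_disjoint.mono_right (Finset.erase_subset _ _)))
          (U.T_disj_W (by simp [hk])) (U.T_disj_W (by simp))
          (U.Hub_sub_W _ hq) (U.Hub_sub_W _ hr) (U.Hub_sub_Y _ hq) (U.Hub_sub_Y _ hr)
        have hsub : U.W (J \ K) ∪ U.T k ∪ U.W (K.erase k) ⊆ U.W J := by
          rintro y ((hy | hy) | hy)
          · exact U.W_mono hJK hy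
          · exact U.T_sub_W (hKJ hk) hy
          · exact U.W_mono hKJ' hy
        refine ⟨p, U.Hub_mono hJK hp, s, U.Hub_mono hKJ' hs,
          X.image (· + (τ + g)) ∪ X.image (· + (τ + g')), ?_, ?_, Or.inr ?_⟩
        · obtain ⟨x, hx⟩ := hX
          exact ⟨x + (τ + g), Finset.mem_union_left _ (Finset.mem_image_of_mem _ hx)⟩
        · intro x hx
          rcases Finset.mem_union.1 hx with hx | hx <;>
          · obtain ⟨y, hy, rfl⟩ := Finset.mem_image.1 hx
            simp only [← add_assoc]
            first
              | exact (hτ p s 0 0 y g (hXP y hy) hg).mono hsub (by simp)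
              | exact (hτ p s 0 0 y g' (hXP y hy) hg').mono hsub (by simp)
        · have := grow X (τ + g) (τ + g') (by simpa using hgg)
          omega

/-- a single branching path -/
lemma pairPath {J Jg Jl Ja : Finset ι} {H : AddSubgroup Γ} {ω d : ℕ} (h : U.Single J H)
    (hA : (Aᶜ : Set Γ).encard ≤ (ω : ℕ∞))
    (hgJ : Jg ⊆ J) (hlg : Jl ⊆ Jg) (hag : Ja ⊆ Jg) (hla : Disjoint Jl Ja)
    {k₁ k₂ k₃ : ι} (hk₁ : k₁ ∈ Jg) (hk₂ : k₂ ∈ Jg) (hk₃ : k₃ ∈ Jg)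
    (h12 : k₁ ≠ k₂) (h13 : k₁ ≠ k₃) (h23 : k₂ ≠ k₃)
    (hk₁l : k₁ ∉ Jl) (hk₂l : k₂ ∉ Jl) (hk₃l : k₃ ∉ Jl)
    (hk₁a : k₁ ∉ Ja) (hk₂a : k₂ ∉ Ja) (hk₃a : k₃ ∉ Ja)
    {s w : V} (hs : s ∈ U.Hub J) (hw : w ∈ U.Hub J) (hsw : s ≠ w)
    (hsg : s ∉ U.W Jg) (hwg : w ∉ U.W Jg) (hl : Jl.card = d + 1)
    {p q : V} (hp : p ∈ U.Hub Ja) (hq : q ∈ U.Hub Ja) (X : Finset Γ) (hX : X.Nonempty)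
    (hXP : ∀ x ∈ X, PV G γ (U.W Ja) 0 p q x)
    (hX' : (∀ x ∈ X, ∀ h ∈ H, x + h ∈ X) ∨ ω + 1 ≤ X.card)
    (hclass : ∃ a ∈ A, ∃ α, PV G γ (U.W J) 0 s w α ∧ a - α ∈ H) :
    ∃ g ∈ A, PV G γ ({s, w} ∪ U.W Jg) d s w g := by
  classical
  obtain ⟨m, hm, m', hm', gl, hgl⟩ := U.long d Jl hl
  have hsY := U.Hub_sub_Y _ hs
  have hwY := U.Hub_sub_Y _ hw
  have dTs : ∀ k, Disjoint (U.T k) {s} := fun k => (U.hTY k).mono_right (by simpa using hsY)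
  have dTw : ∀ k, Disjoint (U.T k) {w} := fun k => (U.hTY k).mono_right (by simpa using hwY)
  have dsl : Disjoint {s} (U.W Jl) := by
    simpa using fun hh => hsg (U.W_mono hlg hh)
  have dsa : Disjoint {s} (U.W Ja) := by
    simpa using fun hh => hsg (U.W_mono hag hh)
  have dwl : Disjoint (U.W Jl) {w} := by
    simpa using fun hh => hwg (U.W_mono hlg hh)
  have dwa : Disjoint (U.W Ja) {w} := by
    simpa using fun hh => hwg (U.W_mono hag hh)
  have dla := U.W_disj hla
  obtain ⟨τ₁, hτ₁⟩ := U.join3 (W₁ := {s}) (W₂ := U.W Jl) (k := k₁) (v := s) (v' := m)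
    dsl (dTs _) (U.T_disj_W hk₁l) rfl (U.Hub_sub_W _ hm) hsY (U.Hub_sub_Y _ hm)
  obtain ⟨τ₂, hτ₂⟩ := U.join3 (W₁ := {s} ∪ U.T k₁ ∪ U.W Jl) (W₂ := U.W Ja) (k := k₂)
    (v := m') (v' := p)
    (by simp only [Set.disjoint_union_left]; exact ⟨⟨dsa, U.T_disj_W hk₁a⟩, dla⟩)
    (by simp only [Set.disjoint_union_right]
        exact ⟨⟨dTs _, U.hT _ _ h12.symm⟩, U.T_disj_W hk₂l⟩)
    (U.T_disj_W hk₂a) (Or.inr (U.Hub_sub_W _ hm')) (U.Hub_sub_W _ hp) (U.Hub_sub_Y _ hm')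
    (U.Hub_sub_Y _ hp)
  obtain ⟨τ₃, hτ₃⟩ := U.join3 (W₁ := {s} ∪ U.T k₁ ∪ U.W Jl ∪ U.T k₂ ∪ U.W Ja) (W₂ := {w})
    (k := k₃) (v := q) (v' := w)
    (by simp only [Set.disjoint_union_left]
        exact ⟨⟨⟨⟨by simpa using hsw, dTw _⟩, dwl⟩, dTw _⟩, dwa⟩)
    (by simp only [Set.disjoint_union_right]
        exact ⟨⟨⟨⟨dTs _, U.hT _ _ h13.symm⟩, U.T_disj_W hk₃l⟩, U.hT _ _ h23.symm⟩,
          U.T_disj_W hk₃a⟩)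
    (dTw _) (Or.inr (U.Hub_sub_W _ hq)) rfl (U.Hub_sub_Y _ hq) hwY
  have key : ∃ z, ∀ x ∈ X, PV G γ ({s, w} ∪ U.W Jg) d s w (x + z) := by
    refine ⟨τ₁ + gl + τ₂ + τ₃, fun x hx => ?_⟩
    have e1 := hτ₁ s m' 0 d 0 gl (PV.nil rfl) hgl
    have e2 := hτ₂ s q _ _ _ _ e1 (hXP x hx)
    have e3 := hτ₃ s w _ 0 _ 0 e2 (PV.nil rfl)
    have e4 := e3.mono (W' := {s, w} ∪ U.W Jg) (l' := d) (by
      rintro y (((((((hy | hy) | hy) | hy) | hy)) | hy) | hy)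
      · cases hy; simp
      · exact Or.inr (U.T_sub_W hk₁ hy)
      · exact Or.inr (U.W_mono hlg hy)
      · exact Or.inr (U.T_sub_W hk₂ hy)
      · exact Or.inr (U.W_mono hag hy)
      · exact Or.inr (U.T_sub_W hk₃ hy)
      · cases hy; simp) (by omega)
    convert e4 using 1
    abel
  obtain ⟨z, hz⟩ := key
  rcases hX' with hX' | hX'
  · obtain ⟨x, hx⟩ := hX
    obtain ⟨a, ha, α, hα, haα⟩ := hclass
    have h1 : PV G γ (U.W J) 0 s w (x + z) := (hz x hx).mono (by
      rintro y ((rfl | hy) | hy)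
      · exact U.Hub_sub_W _ hs
      · cases hy; exact U.Hub_sub_W _ hw
      · exact U.W_mono hgJ hy) (by simp)
    have h2 := h s hs w hw _ _ hα h1
    have h3 := hX' x hx _ (H.add_mem haα h2)
    refine ⟨a, ha, ?_⟩
    have := hz _ h3
    convert this using 1
    abel
  · by_contra hno
    push Not at hno
    have hsub : ((X.image (· + z) : Finset Γ) : Set Γ) ⊆ Aᶜ := by
      intro y hy
      obtain ⟨x, hx, rfl⟩ := Finset.mem_image.1 (Finset.mem_coe.1 hy)
      intro hyA
      exact hno _ hyA (hz x hx)
    have := (Set.encard_le_encard hsub).trans hA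
    rw [Set.encard_coe_eq_coe_finsetCard,
      Finset.card_image_of_injective _ (add_left_injective z)] at this
    have : X.card ≤ ω := by exact_mod_cast this
    omega

end Units

lemma select {Q : Type v} [AddCommGroup Q] (B : Set Q) (h0 : 0 ∈ B) {ω : ℕ}
    (hω : (Bᶜ).encard ≤ (ω : ℕ∞)) {β : Type} (f : β → Q) (D : Finset β) (t : ℕ)
    (hD : t * (ω * t + 1) ≤ D.card) :
    ∃ l : List β, l.Nodup ∧ l.length = t ∧ l.Pairwise (fun x y => f y - f x ∈ B) := by
  classical
  by_cases hq : ∃ q, t ≤ (D.filter (f · = q)).card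
  · obtain ⟨q, hq⟩ := hq
    obtain ⟨E, hE, hEc⟩ := Finset.exists_subset_card_eq hq
    refine ⟨E.toList, E.nodup_toList, by simpa using hEc, ?_⟩
    have hEq : ∀ x ∈ E, f x = q := fun x hx => (Finset.mem_filter.1 (hE hx)).2
    rw [List.pairwise_iff_getElem]
    intro i j hi hj _
    rw [hEq _ (Finset.mem_toList.1 (List.getElem_mem hi)),
      hEq _ (Finset.mem_toList.1 (List.getElem_mem hj))]
    simpa using h0
  push Not at hq
  have hfin : (Bᶜ).Finite := Set.finite_of_encard_le_coe hω
  have hcard : hfin.toFinset.card ≤ ω := by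
    rw [hfin.encard_eq_coe_toFinset_card] at hω
    exact_mod_cast hω
  have key : ∀ s : ℕ, ∀ D' ⊆ D, s * (ω * t + 1) ≤ D'.card →
      ∃ l : List β, l.Nodup ∧ l.length = s ∧ (∀ x ∈ l, x ∈ D') ∧
        l.Pairwise (fun x y => f y - f x ∈ B) := by
    intro s
    induction s with
    | zero => intro D' _ _; exact ⟨[], by simp⟩
    | succ s ih =>
      intro D' hD' hc
      obtain ⟨b, hb⟩ := Finset.card_pos.1 (lt_of_lt_of_le (by positivity) hc)
      set R := hfin.toFinset.biUnion (fun q => D.filter (f · = q + f b)) with hR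
      have hRc : R.card ≤ ω * t := by
        refine (Finset.card_biUnion_le_card_mul _ _ t fun q _ => (hq _).le).trans ?_
        exact Nat.mul_le_mul_right _ hcard
      have hRc' : (insert b R).card ≤ ω * t + 1 :=
        (Finset.card_insert_le _ _).trans (by omega)
      have hle := Finset.le_card_sdiff (insert b R) D'
      have e : (s + 1) * (ω * t + 1) = s * (ω * t + 1) + (ω * t + 1) := by ring
      obtain ⟨l, h1, h2, h3, h4⟩ := ih (D' \ insert b R) (Finset.sdiff_subset.trans hD')
        (by omega)
      refine ⟨b :: l, ?_, by simp [h2], ?_, ?_⟩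
      · rw [List.nodup_cons]
        refine ⟨fun hbl => ?_, h1⟩
        have := h3 b hbl
        simp at this
      · intro x hx
        rcases List.mem_cons.1 hx with rfl | hx
        · exact hb
        · exact (Finset.mem_sdiff.1 (h3 x hx)).1
      · rw [List.pairwise_cons]
        refine ⟨fun x hx => ?_, h4⟩
        by_contra hxB
        have hx3 := Finset.mem_sdiff.1 (h3 x hx)
        apply hx3.2
        apply Finset.mem_insert_of_mem
        rw [hR, Finset.mem_biUnion]
        exact ⟨f x - f b, by simpa using hxB, by simp [hD' hx3.1]⟩
  obtain ⟨l, h1, h2, _, h4⟩ := key t D subset_rfl hD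
  exact ⟨l, h1, h2, h4⟩

/-- size needed in one step -/
def stepSize (ω t d n : ℕ) : ℕ :=
  (t * (ω * t + 1) + 1) + t * t * ((ω * (n + 1) + 1) + (d + 1) + 3) + 3

/-- index type -/
abbrev Kap (M t a d : ℕ) : Type :=
  Fin (M + 1) ⊕ ((Fin t × Fin t) × (Fin a ⊕ Fin (d + 1) ⊕ Fin 3))

namespace Units
variable {V : Type u} {Γ : Type v} [AddCommGroup Γ] {G : SimpleGraph V} {γ : Sym2 V → Γ}
  {A : Set Γ} {ι : Type} (U : Units G γ A ι)

lemma step {J : Finset ι} {H : AddSubgroup Γ} {ω t d n : ℕ} (h : U.Single J H)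
    (hA : (Aᶜ : Set Γ).encard ≤ (ω : ℕ∞)) (hJ : stepSize ω t d n ≤ J.card) :
    ContainsADSubdivision G γ A t d ∨
    ∃ J' ⊆ J, n ≤ J'.card ∧ ∃ S : AddSubgroup Γ, Finite S ∧ Nat.card S ≤ ω ∧ S < H ∧
      U.Single J' S := by
  classical
  by_cases alt : ∃ J' ⊆ J, n ≤ J'.card ∧ ∃ S : AddSubgroup Γ, Finite S ∧ Nat.card S ≤ ω ∧
      ¬ H ≤ S ∧ U.Single J' S
  · right
    obtain ⟨J', h1, h2, S, hf, hc, hH, hS⟩ := alt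
    refine ⟨J', h1, h2, H ⊓ S, ?_, ?_, ?_, ?_⟩
    · exact Finite.of_injective (AddSubgroup.inclusion (inf_le_right : H ⊓ S ≤ S))
        (AddSubgroup.inclusion_injective _)
    · exact (Nat.card_le_card_of_injective (AddSubgroup.inclusion (inf_le_right : H ⊓ S ≤ S))
        (AddSubgroup.inclusion_injective _)).trans hc
    · exact lt_of_le_of_ne inf_le_left fun he => hH (inf_eq_left.1 he)
    · intro a ha b hb g g' hg hg'
      exact ⟨h.mono h1 a ha b hb g g' hg hg', hS a ha b hb g g' hg hg'⟩
  left
  have hJ3 : 3 ≤ J.card := by unfold stepSize at hJ; omega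
  set M := t * (ω * t + 1) with hM
  have hκ : Fintype.card (Kap M t (ω * (n + 1) + 1) d) ≤ Fintype.card J := by
    simp only [Kap, Fintype.card_sum, Fintype.card_prod, Fintype.card_fin, Fintype.card_coe]
    unfold stepSize at hJ
    have : ω * (n + 1) + 1 + (d + 1 + 3) = (ω * (n + 1) + 1) + (d + 1) + 3 := by ring
    rw [this]; omega
  obtain ⟨e'⟩ := Function.Embedding.nonempty_of_card_le hκ
  let e : Kap M t (ω * (n + 1) + 1) d → ι := fun z => (e' z).1
  have he : Function.Injective e := fun z z' hz => e'.injective (Subtype.ext hz)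
  have heJ : ∀ z, e z ∈ J := fun z => (e' z).2
  choose x hx _ using U.cyc
  have hxinj : Function.Injective x := by
    intro i j hij
    by_contra hne
    exact Set.disjoint_left.1 (U.hC i j hne) (hx i) (hij ▸ hx j)
  -- hub vertices
  let y : Fin (M + 1) → V := fun i => x (e (Sum.inl i))
  have hyinj : Function.Injective y := fun i j hij => Sum.inl_injective (he (hxinj hij))
  have hyH : ∀ i, y i ∈ U.Hub J := fun i => ⟨_, heJ _, hx _⟩
  have hval : ∀ i : Fin M, ∃ g, PV G γ (U.W J) 0 (y 0) (y i.succ) g := by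
    intro i
    obtain ⟨g, -, hg⟩ := U.conn_in (heJ (Sum.inl 0)) (hyH 0) (hyH i.succ)
      (fun hh => (Fin.succ_ne_zero i) (hyinj hh).symm)
    exact ⟨g, hg⟩
  choose val hval using hval
  let B : Set (Γ ⧸ H) := (QuotientAddGroup.mk : Γ → Γ ⧸ H) '' A
  obtain ⟨c, hcA, hcH⟩ := h.cyc_mem hJ3
  obtain ⟨l, hl1, hl2, hl3⟩ := select B ⟨c, hcA, (QuotientAddGroup.eq_zero_iff c).2 hcH⟩
    (ω := ω) (by
      refine le_trans (Set.encard_le_encard (t := (QuotientAddGroup.mk : Γ → Γ ⧸ H) '' Aᶜ) ?_)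
        ((Set.encard_image_le _ _).trans hA)
      intro q hq
      obtain ⟨g, rfl⟩ := QuotientAddGroup.mk_surjective q
      exact ⟨g, fun hg => hq ⟨g, hg, rfl⟩, rfl⟩)
    (fun i : Fin M => (QuotientAddGroup.mk (val i) : Γ ⧸ H)) Finset.univ t (by simp [hM])
  let r : Fin t → Fin M := fun i => l[i.1]'(by rw [hl2]; exact i.2)
  have hr : Function.Injective r := by
    intro i j hij
    exact Fin.ext ((hl1.getElem_inj_iff).1 hij)
  have hr2 : ∀ i j, i < j → (QuotientAddGroup.mk (val (r j)) : Γ ⧸ H) -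
      QuotientAddGroup.mk (val (r i)) ∈ B := by
    intro i j hij
    exact List.pairwise_iff_getElem.1 hl3 i.1 j.1 _ _ hij
  let b : Fin t → V := fun i => y (r i).succ
  have hb : Function.Injective b := fun i j hij => hr (Fin.succ_injective _ (hyinj hij))
  -- the groups
  let Ja : Fin t → Fin t → Finset ι := fun i j =>
    Finset.univ.image fun z => e (Sum.inr ((i, j), Sum.inl z))
  let Jl : Fin t → Fin t → Finset ι := fun i j =>
    Finset.univ.image fun z => e (Sum.inr ((i, j), Sum.inr (Sum.inl z)))
  let Jg : Fin t → Fin t → Finset ι := fun i j =>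
    Finset.univ.image fun z => e (Sum.inr ((i, j), z))
  have hbg : ∀ i j k, b k ∉ U.W (Jg i j) := by
    intro i j k
    have hd : Disjoint ({e (Sum.inl (r k).succ)} : Finset ι) (Jg i j) := by
      simp only [Finset.disjoint_singleton_left, Jg, Finset.mem_image, not_exists]
      rintro z ⟨-, hz⟩
      exact absurd (he hz) (by simp)
    exact Set.disjoint_left.1 (U.W_disj hd) (U.C_sub_W (by simp) (hx _))
  refine assemble b hb (fun i j => U.W (Jg i j)) hbg ?_ ?_
  · intro i j k l hne
    apply U.W_disj
    rw [Finset.disjoint_left]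
    intro z hz hz'
    obtain ⟨z1, -, rfl⟩ := Finset.mem_image.1 hz
    obtain ⟨z2, -, h2⟩ := Finset.mem_image.1 hz'
    have := he h2
    simp only [Sum.inr.injEq, Prod.mk.injEq] at this
    exact hne (by rw [this.1.1, this.1.2])
  intro i j hij
  have hagJ : Ja i j ⊆ Jg i j := by
    intro z hz
    obtain ⟨z1, -, rfl⟩ := Finset.mem_image.1 hz
    exact Finset.mem_image.2 ⟨_, Finset.mem_univ _, rfl⟩
  have hlgJ : Jl i j ⊆ Jg i j := by
    intro z hz
    obtain ⟨z1, -, rfl⟩ := Finset.mem_image.1 hz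
    exact Finset.mem_image.2 ⟨_, Finset.mem_univ _, rfl⟩
  have hgJ : Jg i j ⊆ J := by
    intro z hz
    obtain ⟨z1, -, rfl⟩ := Finset.mem_image.1 hz
    exact heJ _
  have hca : (Ja i j).card = ω * (n + 1) + 1 := by
    rw [Finset.card_image_of_injective]
    · simp
    · intro z z' hz
      simpa using he hz
  have hcl : (Jl i j).card = d + 1 := by
    rw [Finset.card_image_of_injective]
    · simp
    · intro z z' hz
      simpa using he hz
  rcases U.accumulate (H := H) (n := n) (ω := ω) ω le_rfl (Ja i j) hca.ge with
    ⟨J', h1, h2⟩ | ⟨p, hp, q, hq, X, hX, hXP, hX'⟩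
  · exact absurd ⟨J', h1.trans (hagJ.trans hgJ), h2⟩ alt
  let k : Fin 3 → ι := fun m => e (Sum.inr ((i, j), Sum.inr (Sum.inr m)))
  have hkinj : Function.Injective k := by
    intro z z' hz
    simpa using he hz
  have hkg : ∀ m, k m ∈ Jg i j := fun m => Finset.mem_image.2 ⟨_, Finset.mem_univ _, rfl⟩
  have hkl : ∀ m, k m ∉ Jl i j := by
    intro m hm
    obtain ⟨z, -, hz⟩ := Finset.mem_image.1 hm
    exact absurd (he hz) (by simp)
  have hka : ∀ m, k m ∉ Ja i j := by
    intro m hm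
    obtain ⟨z, -, hz⟩ := Finset.mem_image.1 hm
    exact absurd (he hz) (by simp)
  have hla : Disjoint (Jl i j) (Ja i j) := by
    rw [Finset.disjoint_left]
    intro z hz hz'
    obtain ⟨z1, -, rfl⟩ := Finset.mem_image.1 hz
    obtain ⟨z2, -, h2⟩ := Finset.mem_image.1 hz'
    exact absurd (he h2) (by simp)
  have hne : b i ≠ b j := fun hh => hij.ne (hb hh)
  refine U.pairPath (k₁ := k 0) (k₂ := k 1) (k₃ := k 2) h hA hgJ hlgJ hagJ hla (hkg _) (hkg _) (hkg _)
    (fun hh => absurd (hkinj hh) (by decide)) (fun hh => absurd (hkinj hh) (by decide))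
    (fun hh => absurd (hkinj hh) (by decide)) (hkl _) (hkl _) (hkl _) (hka _) (hka _) (hka _)
    (hyH _) (hyH _) hne (hbg i j i) (hbg i j j) hcl hp hq X hX hXP hX' ?_
  obtain ⟨a, ha, haq⟩ := hr2 i j hij
  obtain ⟨α, -, hα⟩ := U.conn_in (heJ (Sum.inl 0)) (hyH (r i).succ) (hyH (r j).succ) hne
  refine ⟨a, ha, α, hα, ?_⟩
  rw [← QuotientAddGroup.mk_sub, eq_comm, QuotientAddGroup.eq] at haq
  have h0 : ∀ m : Fin M, y 0 ≠ y m.succ := fun m hh => (Fin.succ_ne_zero m) (hyinj hh).symm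
  have q1 := h.add (by omega) (hyH 0) (hyH (r i).succ) (hyH (r j).succ) (h0 _) hne (h0 _)
    (hval (r i)) hα (hval (r j))
  have := H.sub_mem haq q1
  convert this using 1
  abel

end Units

/-- iterated sizes -/
def iterSize (ω t d : ℕ) : ℕ → ℕ
  | 0 => 0
  | h + 1 => stepSize ω t d (iterSize ω t d h)

namespace Units
variable {V : Type u} {Γ : Type v} [AddCommGroup Γ] {G : SimpleGraph V} {γ : Sym2 V → Γ}
  {A : Set Γ} {ι : Type} (U : Units G γ A ι)

lemma iter {ω t d : ℕ} (hA : (Aᶜ : Set Γ).encard ≤ (ω : ℕ∞)) : ∀ (h : ℕ) (J : Finset ι)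
    (H : AddSubgroup Γ), Finite H → Nat.card H ≤ h → U.Single J H →
    iterSize ω t d h ≤ J.card → ContainsADSubdivision G γ A t d := by
  intro h
  induction h with
  | zero =>
    intro J H hf hc
    have := Nat.card_pos (α := H)
    omega
  | succ h ih =>
    intro J H hf hc hS hJ
    rcases U.step hS hA hJ with hh | ⟨J', h1, h2, S, hSf, hSc, hlt, hSS⟩
    · exact hh
    · refine ih J' S hSf ?_ hSS h2
      have : Nat.card S < Nat.card H :=
        Set.ncard_lt_ncard (s := (S : Set Γ)) (t := (H : Set Γ)) hlt (Set.toFinite _)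
      omega

lemma main [Fintype ι] (U : Units G γ A ι) {ω t d : ℕ} (hA : (Aᶜ : Set Γ).encard ≤ (ω : ℕ∞))
    (hι : iterSize ω t d (ω + 1) ≤ Fintype.card ι) : ContainsADSubdivision G γ A t d := by
  have h0 : U.Single Finset.univ ⊤ := fun _ _ _ _ _ _ _ _ => AddSubgroup.mem_top _
  rcases U.step (t := t) (d := d) (n := iterSize ω t d ω) h0 hA hι with
    hh | ⟨J', h1, h2, S, hSf, hSc, hlt, hSS⟩
  · exact hh
  · exact U.iter hA ω J' S hSf hSc hSS h2

end Units

section levels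
variable {V : Type u} {Γ : Type v} [AddCommGroup Γ] {G : SimpleGraph V} {γ : Sym2 V → Γ}
  {A : Set Γ}

/-- `S` can be partitioned into `k` parts without `A`-cycles. -/
def Col (G : SimpleGraph V) (γ : Sym2 V → Γ) (A : Set Γ) (S : Set V) (k : ℕ) : Prop :=
  ∃ f : V → ℕ, (∀ x ∈ S, f x < k) ∧ ∀ i, NoCycleValIn G γ A {x | x ∈ S ∧ f x = i}

lemma noCycle_subsingleton {S : Set V} (hS : S.Subsingleton) : NoCycleValIn G γ A S := by
  intro v w hw hs
  exfalso
  cases w with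
  | nil => simp at hw
  | cons h p =>
    exact h.ne (hS (hs _ (by simp)) (hs _ (by simp)))

lemma NoCycleValIn.mono {S S' : Set V} (h : NoCycleValIn G γ A S) (hs : S' ⊆ S) :
    NoCycleValIn G γ A S' := fun v w hw hx => h v w hw fun x hxw => hs (hx x hxw)

lemma disjoint_cycles [Finite V] : ∀ (n : ℕ) (S : Set V), ¬ Col G γ A S (2 * n) →
    ∃ C : Fin n → Set V, (∀ j, C j ⊆ S) ∧ (∀ i j, i ≠ j → Disjoint (C i) (C j)) ∧
      ∀ j, ¬ NoCycleValIn G γ A (C j) := by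
  intro n
  induction n with
  | zero => intro S _; exact ⟨fun _ => ∅, by simp, by simp, fun j => j.elim0⟩
  | succ n ih =>
    intro S hS
    have h1 : ¬ NoCycleValIn G γ A S := by
      intro h
      exact hS ⟨fun _ => 0, fun _ _ => by dsimp only; omega, fun i => h.mono fun x hx => hx.1⟩
    obtain ⟨S', ⟨hS'S, hS'⟩, hmin⟩ := Set.Finite.exists_minimal
      (s := {R : Set V | R ⊆ S ∧ ¬ NoCycleValIn G γ A R}) (Set.toFinite _) ⟨S, subset_rfl, h1⟩
    have hne : S'.Nonempty := by
      by_contra hempty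
      rw [Set.not_nonempty_iff_eq_empty] at hempty
      exact hS' (hempty ▸ noCycle_subsingleton Set.subsingleton_empty)
    obtain ⟨z, hz⟩ := hne
    have hz' : NoCycleValIn G γ A (S' \ {z}) := by
      by_contra hno
      have := hmin ⟨Set.sdiff_subset.trans hS'S, hno⟩ Set.sdiff_subset hz
      simp at this
    have hrest : ¬ Col G γ A (S \ S') (2 * n) := by
      rintro ⟨f, hf1, hf2⟩
      apply hS
      classical
      refine ⟨fun x => if x = z then 2 * n else if x ∈ S' then 2 * n + 1 else f x, ?_, ?_⟩
      · intro x hx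
        dsimp only
        split_ifs with ha hb
        · omega
        · omega
        · have := hf1 x ⟨hx, hb⟩; omega
      · intro i
        by_cases hi : i = 2 * n
        · refine (noCycle_subsingleton (Set.subsingleton_singleton (a := z))).mono ?_
          rintro x ⟨hx, hxi⟩
          dsimp only at hxi
          split_ifs at hxi with ha hb
          · exact ha
          · omega
          · have := hf1 x ⟨hx, hb⟩; omega
        by_cases hi' : i = 2 * n + 1
        · refine hz'.mono ?_
          rintro x ⟨hx, hxi⟩
          dsimp only at hxi
          split_ifs at hxi with ha hb
          · omega
          · exact ⟨hb, ha⟩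
          · have := hf1 x ⟨hx, hb⟩; omega
        · refine (hf2 i).mono ?_
          rintro x ⟨hx, hxi⟩
          dsimp only at hxi
          split_ifs at hxi with ha hb
          · omega
          · omega
          · exact ⟨⟨hx, hb⟩, hxi⟩
    obtain ⟨C, hC1, hC2, hC3⟩ := ih _ hrest
    refine ⟨Fin.cons S' C, ?_, ?_, ?_⟩
    · intro j
      refine Fin.cases ?_ (fun j => ?_) j
      · exact hS'S
      · exact (hC1 j).trans Set.sdiff_subset
    · have hd : ∀ j, Disjoint S' (C j) := fun j =>
        (Set.disjoint_sdiff_right).mono_right (hC1 j)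
      intro i j
      refine Fin.cases ?_ (fun i => ?_) i <;> refine Fin.cases ?_ (fun j => ?_) j
      · simp
      · intro _; exact hd j
      · intro _; exact (hd i).symm
      · intro hij
        exact hC2 i j (fun hh => hij (by rw [hh]))
    · intro j
      refine Fin.cases ?_ (fun j => ?_) j
      · exact hS'
      · exact hC3 j

lemma cycle_split {S : Set V} (h : ¬ NoCycleValIn G γ A S) :
    ∃ x ∈ S, ∃ y ∈ S, x ≠ y ∧ ∃ g g', PV G γ S 0 x y g ∧
      PV G γ S 0 x y g' ∧ g + g' ∈ A := by
  unfold NoCycleValIn at h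
  push Not at h
  obtain ⟨x, w, hw, hs, hA⟩ := h
  cases w with
  | nil => simp at hw
  | @cons _ y _ hadj p =>
    have hp : p.IsPath := ((SimpleGraph.Walk.cons_isCycle_iff p hadj).1 hw).1
    have hxS : x ∈ S := hs _ (by simp)
    have hyS : y ∈ S := hs _ (by simp)
    have e : PV G γ S 0 x y (γ s(x, y)) := by
      refine ⟨SimpleGraph.Walk.cons hadj SimpleGraph.Walk.nil, ?_, ?_, by simp [walkVal], by simp⟩
      · simp [SimpleGraph.Walk.cons_isPath_iff, hadj.ne]
      · intro z hz
        simp only [SimpleGraph.Walk.support_cons, SimpleGraph.Walk.support_nil,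
          List.mem_cons, List.not_mem_nil, or_false] at hz
        rcases hz with rfl | rfl
        · exact hxS
        · exact hyS
    refine ⟨x, hxS, y, hyS, hadj.ne, γ s(x, y), walkVal γ p, e, ?_, ?_⟩
    · exact PV.symm ⟨p, hp, fun z hz => hs z (by simp [hz]), rfl, by simp⟩
    · simpa [walkVal] using hA

/-- breadth-first search -/
lemma bfs {Y : Set V} {k : ℕ} (hY : ¬ Col G γ A Y (2 * k)) :
    ∃ Y' ⊆ Y, ∃ T ⊆ Y, Disjoint T Y' ∧ ¬ Col G γ A Y' k ∧
      ∀ a ∈ Y', ∀ b ∈ Y', a ≠ b → ∃ g, PV G γ ({a, b} ∪ T) 1 a b g := by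
  classical
  let H := G.induce Y
  let root : H.ConnectedComponent → Y := fun c => c.out
  have hroot : ∀ c, H.connectedComponentMk (root c) = c := fun c => Quot.out_eq c
  let L : H.ConnectedComponent → ℕ → Set V := fun c i =>
    {x | ∃ h : x ∈ Y, H.connectedComponentMk ⟨x, h⟩ = c ∧ H.dist (root c) ⟨x, h⟩ = i}
  have hex : ∃ c i, ¬ Col G γ A (L c i) k := by
    by_contra hno
    push Not at hno
    choose f hf1 hf2 using hno
    let comp : Y → H.ConnectedComponent := fun x => H.connectedComponentMk x
    let lev : Y → ℕ := fun x => H.dist (root (comp x)) x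
    apply hY
    let F : V → ℕ := fun x => if h : x ∈ Y then
      2 * f (comp ⟨x, h⟩) (lev ⟨x, h⟩) x + lev ⟨x, h⟩ % 2 else 0
    have hL : ∀ x (h : x ∈ Y), x ∈ L (comp ⟨x, h⟩) (lev ⟨x, h⟩) := fun x h => ⟨h, rfl, rfl⟩
    have hF : ∀ x (h : x ∈ Y), F x = 2 * f (comp ⟨x, h⟩) (lev ⟨x, h⟩) x + lev ⟨x, h⟩ % 2 := by
      intro x h; simp [F, h]
    have hadj : ∀ x (hx : x ∈ Y) y (hy : y ∈ Y), G.Adj x y → F x = F y →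
        comp ⟨x, hx⟩ = comp ⟨y, hy⟩ ∧ lev ⟨x, hx⟩ = lev ⟨y, hy⟩ := by
      intro x hx y hy hxy hFxy
      have hH : H.Adj ⟨x, hx⟩ ⟨y, hy⟩ := hxy
      have hc : comp ⟨x, hx⟩ = comp ⟨y, hy⟩ :=
        SimpleGraph.ConnectedComponent.sound hH.reachable
      refine ⟨hc, ?_⟩
      have hreach : ∀ z, comp z = comp ⟨x, hx⟩ → H.Reachable (root (comp ⟨x, hx⟩)) z := by
        intro z hz
        exact SimpleGraph.ConnectedComponent.exact ((hroot _).trans hz.symm)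
      have l1 : lev ⟨x, hx⟩ = H.dist (root (comp ⟨x, hx⟩)) ⟨x, hx⟩ := rfl
      have l2 : lev ⟨y, hy⟩ = H.dist (root (comp ⟨x, hx⟩)) ⟨y, hy⟩ := by
        simp only [lev, hc]
      obtain ⟨p, hp⟩ := (hreach _ rfl).exists_walk_length_eq_dist
      obtain ⟨q, hq⟩ := (hreach _ hc.symm).exists_walk_length_eq_dist
      have d1 := SimpleGraph.dist_le (p.concat hH)
      have d2 := SimpleGraph.dist_le (q.concat hH.symm)
      rw [SimpleGraph.Walk.length_concat] at d1 d2
      rw [hF x hx, hF y hy] at hFxy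
      omega
    refine ⟨F, ?_, ?_⟩
    · intro x hx
      rw [hF x hx]
      have := hf1 _ _ x (hL x hx)
      omega
    · intro i v w hw hs
      have hwalk : ∀ {a b : V} (p : G.Walk a b),
          (∀ x ∈ p.support, x ∈ {x | x ∈ Y ∧ F x = i}) → ∀ (ha : a ∈ Y), ∀ x ∈ p.support,
          ∃ hx : x ∈ Y, comp ⟨x, hx⟩ = comp ⟨a, ha⟩ ∧ lev ⟨x, hx⟩ = lev ⟨a, ha⟩ := by
        intro a b p
        induction p with
        | nil =>
          intro _ ha x hx
          simp only [SimpleGraph.Walk.support_nil, List.mem_singleton] at hx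
          subst hx
          exact ⟨ha, rfl, rfl⟩
        | @cons a c b hac p ih =>
          intro hp ha x hx
          rw [SimpleGraph.Walk.support_cons, List.mem_cons] at hx
          rcases hx with rfl | hx
          · exact ⟨ha, rfl, rfl⟩
          · have hcS := hp c (by simp)
            have haS := hp a (by simp)
            obtain ⟨hxY, e1, e2⟩ := ih (fun z hz => hp z (by simp [hz])) hcS.1 x hx
            obtain ⟨e3, e4⟩ := hadj a ha c hcS.1 hac (haS.2.trans hcS.2.symm)
            exact ⟨hxY, e1.trans e3.symm, e2.trans e4.symm⟩
      have hvY : v ∈ Y := (hs v (by simp)).1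
      refine hf2 (comp ⟨v, hvY⟩) (lev ⟨v, hvY⟩) (f (comp ⟨v, hvY⟩) (lev ⟨v, hvY⟩) v) v w hw ?_
      intro x hx
      obtain ⟨hxY, e1, e2⟩ := hwalk w hs hvY x hx
      have hxL := hL x hxY
      have Fx := hF x hxY
      have Fv := hF v hvY
      rw [e1, e2] at hxL Fx
      have := (hs x hx).2
      have := (hs v (by simp)).2
      refine ⟨hxL, ?_⟩
      omega
  obtain ⟨c, i, hci⟩ := hex
  refine ⟨L c i, fun x hx => hx.1, {x | ∃ h : x ∈ Y, H.connectedComponentMk ⟨x, h⟩ = c ∧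
    H.dist (root c) ⟨x, h⟩ < i}, fun x hx => hx.1, ?_, hci, ?_⟩
  · rw [Set.disjoint_left]
    rintro x ⟨h, -, h1⟩ ⟨h', -, h2⟩
    omega
  set T : Set V := {x | ∃ h : x ∈ Y, H.connectedComponentMk ⟨x, h⟩ = c ∧
    H.dist (root c) ⟨x, h⟩ < i} with hT
  have hup : ∀ a ∈ L c i, ∃ p : G.Walk (root c).1 a, ∀ x ∈ p.support, x = a ∨ x ∈ T := by
    rintro a ⟨ha, hac, hai⟩
    have hreach : H.Reachable (root c) ⟨a, ha⟩ :=
      SimpleGraph.ConnectedComponent.exact ((hroot _).trans hac.symm)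
    obtain ⟨p, hp⟩ := hreach.exists_walk_length_eq_dist
    refine ⟨p.map (SimpleGraph.Embedding.induce Y).toHom, ?_⟩
    intro x hx
    have hx' : x ∈ p.support.map (SimpleGraph.Embedding.induce Y (G := G)).toHom :=
      (congrArg (fun l => x ∈ l)
        (SimpleGraph.Walk.support_map (SimpleGraph.Embedding.induce Y (G := G)).toHom p)).mp hx
    obtain ⟨z, hz, rfl⟩ := List.mem_map.1 hx'
    by_cases hza : z = ⟨a, ha⟩
    · left; rw [hza]; rfl
    · right
      refine ⟨z.2, ?_, ?_⟩
      · rw [← hroot c]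
        exact SimpleGraph.ConnectedComponent.sound (p.takeUntil z hz).reachable.symm
      · have h1 := SimpleGraph.dist_le (p.takeUntil z hz)
        have h2 := SimpleGraph.Walk.length_takeUntil_lt_length hz hza
        show H.dist (root c) z < i
        omega
  intro a ha b hb hab
  obtain ⟨p, hp⟩ := hup a ha
  obtain ⟨q, hq⟩ := hup b hb
  refine ⟨_, (p.reverse.append q).bypass, SimpleGraph.Walk.bypass_isPath _, ?_, rfl, ?_⟩
  · intro x hx
    have := SimpleGraph.Walk.support_bypass_subset_support _ hx
    rw [SimpleGraph.Walk.mem_support_append_iff] at this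
    rcases this with h | h
    · rcases hp x (by simpa using h) with rfl | h
      · simp
      · exact Or.inr h
    · rcases hq x h with rfl | h
      · simp
      · exact Or.inr h
  · by_contra hlt
    exact hab (SimpleGraph.Walk.eq_of_length_eq_zero
      (p := (p.reverse.append q).bypass) (by omega))

lemma connectors : ∀ (n k : ℕ) (Y : Set V), ¬ Col G γ A Y (2 ^ n * k) →
    ∃ Y' ⊆ Y, ∃ T : Fin n → Set V, (∀ j, T j ⊆ Y) ∧ (∀ j, Disjoint (T j) Y') ∧
      (∀ i j, i ≠ j → Disjoint (T i) (T j)) ∧ ¬ Col G γ A Y' k ∧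
      ∀ j, ∀ a ∈ Y', ∀ b ∈ Y', a ≠ b → ∃ g, PV G γ ({a, b} ∪ T j) 1 a b g := by
  intro n
  induction n with
  | zero =>
    intro k Y hY
    exact ⟨Y, subset_rfl, fun _ => ∅, by simp, by simp, by simp, by simpa using hY,
      fun j => j.elim0⟩
  | succ n ih =>
    intro k Y hY
    obtain ⟨Y₁, hY₁, T₀, hT₀, hd, hc, hconn⟩ := bfs (G := G) (γ := γ) (A := A) (Y := Y)
      (k := 2 ^ n * k) (by
        have : 2 * (2 ^ n * k) = 2 ^ (n + 1) * k := by ring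
        rwa [this])
    obtain ⟨Y', hY', T, h1, h2, h3, h4, h5⟩ := ih k Y₁ hc
    refine ⟨Y', hY'.trans hY₁, Fin.cons T₀ T, ?_, ?_, ?_, h4, ?_⟩
    · intro j
      refine Fin.cases ?_ (fun j => ?_) j
      · exact hT₀
      · exact (h1 j).trans hY₁
    · intro j
      refine Fin.cases ?_ (fun j => ?_) j
      · exact hd.mono_right hY'
      · exact h2 j
    · have hd : ∀ j, Disjoint T₀ (T j) := fun j => hd.mono_right (h1 j)
      intro i j
      refine Fin.cases ?_ (fun i => ?_) i <;> refine Fin.cases ?_ (fun j => ?_) j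
      · simp
      · intro _; exact hd j
      · intro _; exact (hd i).symm
      · intro hij
        exact h3 i j (fun hh => hij (by rw [hh]))
    · intro j
      refine Fin.cases ?_ (fun j => ?_) j
      · intro a ha b hb hab
        exact hconn a (hY' ha) b (hY' hb) hab
      · exact h5 j

lemma units_exist [Finite V] (n : ℕ) (h : ¬ Col G γ A Set.univ (2 ^ n * (2 * n))) :
    Nonempty (Units G γ A (Fin n)) := by
  obtain ⟨Y, -, T, -, h2, h3, h4, h5⟩ := connectors n (2 * n) Set.univ h
  obtain ⟨C, c1, c2, c3⟩ := disjoint_cycles n Y h4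
  exact ⟨⟨Y, T, C, c1, c2, h3, h2, h5, fun j => cycle_split (c3 j)⟩⟩

lemma not_col_of_lt_arb {k : ℕ} (h : k < arb G γ A) : ¬ Col G γ A Set.univ k := by
  rintro ⟨f, hf1, hf2⟩
  have : arb G γ A ≤ k := by
    apply Nat.sInf_le
    refine ⟨fun x => ⟨f x, hf1 x trivial⟩, fun i => (hf2 i).mono ?_⟩
    rintro x ⟨-, hx⟩
    exact ⟨trivial, congrArg Fin.val hx⟩
  omega

end levels

theorem statement0 (ω : ℕ) (hω : 0 < ω) :
    ∃ f : ℕ × ℕ → ℝ,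
      ∀ (Γ : Type v) [AddCommGroup Γ] (A : Set Γ), A.Nonempty →
        (Aᶜ : Set Γ).encard ≤ (ω : ℕ∞) →
        ∀ (V : Type u) [Fintype V] (G : SimpleGraph V) (γ : Sym2 V → Γ) (t d : ℕ),
          f (t, d) ≤ (arb G γ A : ℝ) →
          ContainsADSubdivision G γ A t d := by
  refine ⟨fun td => ((2 ^ (iterSize ω td.1 td.2 (ω + 1)) *
    (2 * (iterSize ω td.1 td.2 (ω + 1))) + 1 : ℕ) : ℝ), ?_⟩
  intro Γ _ A _ hA V _ G γ t d hf
  have hlt : 2 ^ (iterSize ω t d (ω + 1)) * (2 * (iterSize ω t d (ω + 1))) < arb G γ A := by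
    have := Nat.cast_le.1 hf
    exact this
  obtain ⟨U⟩ := units_exist _ (not_col_of_lt_arb hlt)
  exact U.main hA (by simp)

end ArbPaper
end

section
/- There is a function g : ℕ → ℕ satisfying the following. Let Γ be an abelian group and let A ⊆ Γ be a non-empty set such that Γ \ A is a subgroup of Γ. Let (G, γ) be a Γ-labelled graph. If arb_{(Γ,A)}(G, γ) ≥ g(t), then G contains a cycle of length at least t whose γ-value is in A. -/
namespace ArbPaper

universe u v

/-! ### Helper material -/

/-- Sum of the labels of consecutive pairs in a list of vertices. -/
def lv {V : Type u} {Γ : Type v} [AddCommGroup Γ] (γ : Sym2 V → Γ) : List V → Γ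
  | [] => 0
  | [_] => 0
  | a :: b :: l => γ s(a, b) + lv γ (b :: l)

theorem lv_split {V : Type u} {Γ : Type v} [AddCommGroup Γ] (γ : Sym2 V → Γ) (c : V)
    (m : List V) : ∀ l : List V, lv γ (l ++ c :: m) = lv γ (l ++ [c]) + lv γ (c :: m)
  | [] => by simp [lv]
  | [a] => by simp [lv]
  | a :: b :: l => by
      have := lv_split γ c m (b :: l)
      simp only [List.cons_append, lv] at this ⊢
      rw [this, add_assoc]

theorem exists_walk {V : Type u} {Γ : Type v} [AddCommGroup Γ] {G : SimpleGraph V}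
    (γ : Sym2 V → Γ) (b : V) : ∀ (l : List V) (a : V), (a :: (l ++ [b])).IsChain G.Adj →
      ∃ w : G.Walk a b, w.support = a :: (l ++ [b]) ∧ walkVal γ w = lv γ (a :: (l ++ [b]))
  | [], a, h => by
      have hab : G.Adj a b := by simpa using h
      refine ⟨.cons hab .nil, by simp, by simp [walkVal, lv]⟩
  | c :: l, a, h => by
      simp only [List.cons_append, List.isChain_cons_cons] at h
      obtain ⟨w, hw, hv⟩ := exists_walk γ b l c h.2
      refine ⟨.cons h.1 w, by simp [hw], ?_⟩
      simp only [walkVal] at hv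
      simp [walkVal, lv, hv]

theorem cycle_val {V : Type u} {Γ : Type v} [AddCommGroup Γ] {G : SimpleGraph V}
    (γ : Sym2 V → Γ) {A : Set Γ} {t : ℕ} (hno : ¬ ContainsADCycle G γ A t)
    {a b : V} {l : List V} (hc : (a :: (l ++ [b])).IsChain G.Adj)
    (hn : (a :: (l ++ [b])).Nodup) (hl : l ≠ []) (hab : G.Adj a b) (ht : t ≤ l.length) :
    lv γ (a :: (l ++ [b])) + γ s(a, b) ∉ A := by
  intro hA
  apply hno
  obtain ⟨c, l, rfl⟩ := List.exists_cons_of_ne_nil hl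
  simp only [List.cons_append, List.isChain_cons_cons] at hc
  obtain ⟨w, hw, hv⟩ := exists_walk γ b l c hc.2
  have hlen : w.length = l.length + 1 := by
    have := congrArg List.length hw
    simp at this
    omega
  refine ⟨b, .cons hab.symm (.cons hc.1 w), ?_, ?_, ?_⟩
  · rw [SimpleGraph.Walk.cons_isCycle_iff, SimpleGraph.Walk.isPath_def]
    constructor
    · simpa [hw] using hn
    · rw [SimpleGraph.Walk.edges_cons, List.mem_cons]
      rintro (h | h)
      · have : c = b := by
          have h2 : c ∈ s(b, a) := by rw [h]; simp
          rw [Sym2.mem_iff] at h2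
          rcases h2 with h2 | h2
          · exact h2
          · exact absurd h2.symm hc.1.ne
        subst this
        simp at hn
      · have h3 := SimpleGraph.Walk.snd_mem_support_of_mem_edges w h
        rw [hw] at h3
        rw [List.nodup_cons] at hn
        exact hn.1 h3
  · simp only [walkVal] at hv
    simp only [walkVal, SimpleGraph.Walk.edges_cons, List.map_cons, List.sum_cons, hv]
    simp only [List.cons_append, lv] at hA
    rw [add_comm, Sym2.eq_swap (a := b)]
    exact hA
  · simp [hlen] at ht ⊢
    omega

/-- A rooted spanning forest, given by the list of vertices from the root to each vertex. -/
structure Forest {V : Type u} (G : SimpleGraph V) (R : V → List V) : Prop where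
  last : ∀ x, ∃ l, R x = l ++ [x]
  nodup : ∀ x, (R x).Nodup
  chain : ∀ x, (R x).IsChain G.Adj
  closed : ∀ x, ∀ y ∈ R x, R y <+: R x

theorem Forest.self_mem {V : Type u} {G : SimpleGraph V} {R : V → List V} (h : Forest G R)
    (x : V) : x ∈ R x := by
  obtain ⟨l, hl⟩ := h.last x
  simp [hl]

theorem Forest.improve {V : Type u} [Fintype V] {G : SimpleGraph V} {R : V → List V}
    (h : Forest G R) {a b : V} (hab : G.Adj a b) (h1 : ¬ R a <+: R b)
    (hle : (R a).length ≤ (R b).length) :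
    ∃ R', Forest G R' ∧ ∑ x, (R x).length < ∑ x, (R' x).length := by
  classical
  have hmoved : ∀ x, R a <+: R x → ∃ L, R x = R a ++ L := fun x hx => by
    obtain ⟨L, hL⟩ := hx
    exact ⟨L, hL.symm⟩
  let R' : V → List V := fun x =>
    if R a <+: R x then R b ++ a :: (R x).drop (R a).length else R x
  have hyes : ∀ x L, R x = R a ++ L → R' x = R b ++ a :: L := fun x L hL => by
    have : R a <+: R x := ⟨L, hL.symm⟩
    simp only [R', if_pos this]
    simp [hL]
  have hno : ∀ x, ¬ R a <+: R x → R' x = R x := fun x hx => by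
    simp only [R', if_neg hx]
  obtain ⟨la, hla⟩ := h.last a
  obtain ⟨lb, hlb⟩ := h.last b
  have hmem : ∀ x L, R x = R a ++ L → ∀ y ∈ L, R a <+: R y := fun x L hL y hy => by
    have hyx : R y <+: R x := h.closed x y (by simp [hL, hy])
    rcases List.prefix_or_prefix_of_prefix hyx (⟨L, hL.symm⟩ : R a <+: R x) with h2 | h2
    · have h3 : y ∈ R a := h2.subset (h.self_mem y)
      have h4 := h.nodup x
      rw [hL, List.nodup_append'] at h4
      exact absurd hy (h4.2.2 h3)
    · exact h2
  have hb : ∀ y ∈ R b, ¬ R a <+: R y := fun y hy h2 => h1 (h2.trans (h.closed b y hy))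
  refine ⟨R', ⟨?_, ?_, ?_, ?_⟩, ?_⟩
  · intro x
    by_cases hx : R a <+: R x
    · obtain ⟨L, hL⟩ := hmoved x hx
      rw [hyes x L hL]
      obtain ⟨lx, hlx⟩ := h.last x
      rcases List.eq_nil_or_concat L with rfl | ⟨L', z, rfl⟩
      · have : a = x := by
          rw [hla, hlx] at hL
          simp at hL
          exact hL.2.symm
        subst this
        exact ⟨R b, rfl⟩
      · have : z = x := by
          rw [hlx, List.concat_eq_append, ← List.append_assoc] at hL
          exact (List.append_inj' hL rfl).2 |> fun h => by simpa using h.symm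
        subst this
        exact ⟨R b ++ a :: L', by simp⟩
    · rw [hno x hx]
      exact h.last x
  · intro x
    by_cases hx : R a <+: R x
    · obtain ⟨L, hL⟩ := hmoved x hx
      rw [hyes x L hL]
      have h4 := h.nodup x
      rw [hL, hla] at h4
      have h5 : (a :: L).Nodup := by
        rw [List.append_assoc] at h4
        exact (List.nodup_append'.1 h4).2.1
      rw [List.nodup_append']
      refine ⟨h.nodup b, h5, ?_⟩
      intro y hy hy2
      rcases List.mem_cons.1 hy2 with rfl | hy2
      · exact h1 (h.closed b _ hy)
      · exact hb y hy (hmem x L hL y hy2)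
    · rw [hno x hx]
      exact h.nodup x
  · intro x
    by_cases hx : R a <+: R x
    · obtain ⟨L, hL⟩ := hmoved x hx
      rw [hyes x L hL]
      have h4 := h.chain x
      rw [hL, hla, List.append_assoc, List.singleton_append] at h4
      have h5 := (List.isChain_split.1 h4).2
      have h6 := h.chain b
      rw [hlb] at h6 ⊢
      rw [List.append_assoc, List.singleton_append, List.isChain_append_cons_cons]
      exact ⟨h6, hab.symm, h5⟩
    · rw [hno x hx]
      exact h.chain x
  · intro x y hy
    by_cases hx : R a <+: R x
    · obtain ⟨L, hL⟩ := hmoved x hx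
      rw [hyes x L hL] at hy ⊢
      rcases List.mem_append.1 hy with hy | hy
      · rw [hno y (hb y hy)]
        exact (h.closed b y hy).trans (List.prefix_append _ _)
      · rcases List.mem_cons.1 hy with rfl | hy
        · rw [hyes y [] (by simp)]
          exact ⟨L, by simp⟩
        · obtain ⟨L', hL'⟩ := hmoved y (hmem x L hL y hy)
          rw [hyes y L' hL']
          have hyx : R y <+: R x := h.closed x y (by simp [hL, hy])
          rw [hL, hL', List.prefix_append_right_inj] at hyx
          rw [List.prefix_append_right_inj]
          simpa using hyx
    · rw [hno x hx] at hy ⊢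
      rw [hno y fun h2 => hx (h2.trans (h.closed x y hy))]
      exact h.closed x y hy
  · apply Finset.sum_lt_sum
    · intro x _
      by_cases hx : R a <+: R x
      · obtain ⟨L, hL⟩ := hmoved x hx
        rw [hyes x L hL, hL]
        simp
        omega
      · rw [hno x hx]
    · refine ⟨a, Finset.mem_univ _, ?_⟩
      rw [hyes a [] (by simp)]
      simp
      omega

/-- Existence of a depth-first-search forest. -/
theorem exists_dfs {V : Type u} [Fintype V] (G : SimpleGraph V) :
    ∃ R, Forest G R ∧ ∀ a b, G.Adj a b → R a <+: R b ∨ R b <+: R a := by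
  classical
  by_contra hcon
  have key : ∀ n : ℕ, ∃ R, Forest G R ∧ n ≤ ∑ x, (R x).length := by
    intro n
    induction n with
    | zero =>
      refine ⟨fun x => [x], ⟨fun x => ⟨[], rfl⟩, by simp, by simp, ?_⟩, Nat.zero_le _⟩
      intro x y hy
      simp at hy
      simp [hy]
    | succ n ih =>
      obtain ⟨R, hR, hn⟩ := ih
      have : ∃ a b, G.Adj a b ∧ ¬ R a <+: R b ∧ ¬ R b <+: R a := by
        by_contra h2
        refine hcon ⟨R, hR, fun a b hab => ?_⟩
        by_contra h3
        exact h2 ⟨a, b, hab, fun h => h3 (Or.inl h), fun h => h3 (Or.inr h)⟩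
      obtain ⟨a, b, hab, h1, h2⟩ := this
      rcases le_total (R a).length (R b).length with hle | hle
      · obtain ⟨R', hR', hlt⟩ := hR.improve hab h1 hle
        exact ⟨R', hR', by omega⟩
      · obtain ⟨R', hR', hlt⟩ := hR.improve hab.symm h2 hle
        exact ⟨R', hR', by omega⟩
  obtain ⟨R, hR, hn⟩ := key (Fintype.card V * Fintype.card V + 1)
  have : ∑ x, (R x).length ≤ ∑ _x : V, Fintype.card V :=
    Finset.sum_le_sum fun x _ => (hR.nodup x).length_le_card
  simp at this
  omega

/-- A relation in which every element has at most one predecessor, of smaller rank,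
can be properly two-coloured. -/
theorem two_color {V : Type u} [Fintype V] (B : V → V → Prop) (r : V → ℕ)
    (hr : ∀ a b, B a b → r a < r b) (hu : ∀ a a' b, B a b → B a' b → a = a') :
    ∃ c : V → Bool, ∀ a b, B a b → c a ≠ c b := by
  classical
  have key : ∀ n : ℕ, ∃ c : V → Bool, ∀ a b, r b < n → B a b → c a ≠ c b := by
    intro n
    induction n with
    | zero => exact ⟨fun _ => true, fun a b h => absurd h (Nat.not_lt_zero _)⟩
    | succ n ih =>
      obtain ⟨c, hc⟩ := ih
      refine ⟨fun b => if r b < n then c b else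
        if h : ∃ a, B a b then !(c h.choose) else true, ?_⟩
      intro a b hb hab
      have h1 := hr a b hab
      have h2 : r a < n := by omega
      by_cases h3 : r b < n
      · simp only [if_pos h2, if_pos h3]
        exact hc a b h3 hab
      · have h4 : ∃ a, B a b := ⟨a, hab⟩
        have h5 : h4.choose = a := hu _ _ _ h4.choose_spec hab
        simp only [if_pos h2, if_neg h3, dif_pos h4, h5]
        simp
  obtain ⟨n, hn⟩ : ∃ n, ∀ b, r b < n :=
    ⟨Finset.univ.sup r + 1, fun b => Nat.lt_succ_of_le (Finset.le_sup (Finset.mem_univ b))⟩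
  obtain ⟨c, hc⟩ := key n
  exact ⟨c, fun a b => hc a b (hn b)⟩

theorem Forest.up {V : Type u} {G : SimpleGraph V} {R : V → List V} (h : Forest G R)
    {a b : V} (hab : R a <+: R b) (hne : a ≠ b) :
    ∃ la l, R a = la ++ [a] ∧ R b = la ++ a :: (l ++ [b]) := by
  obtain ⟨la, hla⟩ := h.last a
  obtain ⟨lb, hlb⟩ := h.last b
  obtain ⟨L, hL⟩ := hab
  rcases List.eq_nil_or_concat L with rfl | ⟨L', z, rfl⟩
  · rw [hla, hlb] at hL
    simp at hL
    exact absurd hL.2 hne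
  · have hz : z = b := by
      rw [hlb, List.concat_eq_append, ← List.append_assoc] at hL
      exact (List.append_inj' hL rfl).2 |> fun h => by simpa using h
    subst hz
    exact ⟨la, L', hla, by rw [← hL, hla]; simp⟩

/-- The fundamental cycle of a long back edge. -/
theorem Forest.long_edge {V : Type u} {Γ : Type v} [AddCommGroup Γ] {G : SimpleGraph V}
    {R : V → List V} (h : Forest G R) (γ : Sym2 V → Γ) {A : Set Γ} {t : ℕ}
    (hno : ¬ ContainsADCycle G γ A t) {a b : V} (hab : G.Adj a b) (hp : R a <+: R b)
    (hlen : (R a).length + (t + 2) ≤ (R b).length) :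
    lv γ (R b) - lv γ (R a) + γ s(a, b) ∉ A := by
  obtain ⟨la, l, ha, hb⟩ := h.up hp hab.ne
  have hc := h.chain b
  have hn := h.nodup b
  rw [ha, hb] at hlen
  rw [hb] at hc hn
  have hl : t + 1 ≤ l.length := by simp at hlen; omega
  have h1 := cycle_val γ hno (List.isChain_split.1 hc).2 (List.nodup_append'.1 hn).2.1
    (by rintro rfl; simp at hl) hab (by omega)
  rw [hb, lv_split, ha]
  simpa using h1

/-- The cycle formed by two nested back edges with the same lower end. -/
theorem Forest.two_edges {V : Type u} {Γ : Type v} [AddCommGroup Γ] {G : SimpleGraph V}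
    {R : V → List V} (h : Forest G R) (γ : Sym2 V → Γ) {A : Set Γ} {t : ℕ}
    (hno : ¬ ContainsADCycle G γ A t) {a b c : V} (hac : G.Adj a c) (hbc : G.Adj b c)
    (hab : a ≠ b) (hp : R a <+: R b) (hq : R b <+: R c)
    (hlen : (R a).length + (t + 2) ≤ (R b).length) :
    lv γ (R b) - lv γ (R a) + γ s(b, c) + γ s(a, c) ∉ A := by
  obtain ⟨la, l, ha, hb⟩ := h.up hp hab
  obtain ⟨lb, l', hb', hc'⟩ := h.up hq hbc.ne
  have hcb : c ∉ R b := by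
    have := h.nodup c
    rw [hc', ← List.singleton_append, ← List.append_assoc, ← hb', List.nodup_append'] at this
    intro h2
    exact this.2.2 h2 (by simp)
  have hc := h.chain b
  have hn := h.nodup b
  rw [ha, hb] at hlen
  rw [hb] at hc hn hcb
  have hl : t + 1 ≤ l.length := by simp at hlen; omega
  have hc2 : (a :: (l ++ [b] ++ [c])).IsChain G.Adj := by
    have := (List.isChain_split.1 hc).2
    have h3 : a :: (l ++ [b] ++ [c]) = (a :: l) ++ b :: c :: [] := by simp
    rw [h3, List.isChain_append_cons_cons]
    exact ⟨by simpa using this, hbc, by simp⟩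
  have hn2 : (a :: (l ++ [b] ++ [c])).Nodup := by
    have := (List.nodup_append'.1 hn).2.1
    have h3 : a :: (l ++ [b] ++ [c]) = (a :: (l ++ [b])) ++ [c] := by simp
    rw [h3, List.nodup_append']
    refine ⟨this, by simp, ?_⟩
    intro y hy hy2
    rw [List.mem_singleton] at hy2
    subst hy2
    exact hcb (List.mem_append_right _ hy)
  have h1 := cycle_val γ hno hc2 hn2 (by simp) hac (by simp; omega)
  have h4 : lv γ (a :: (l ++ [b] ++ [c])) = lv γ (a :: (l ++ [b])) + γ s(b, c) := by
    have := lv_split γ b [c] (a :: l)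
    simpa [lv] using this
  rw [h4] at h1
  rw [hb, lv_split, ha]
  simpa using h1

theorem walk_potential {V : Type u} {Γ : Type v} [AddCommGroup Γ] {G : SimpleGraph V}
    (γ : Sym2 V → Γ) (Λ : AddSubgroup Γ) (p : V → Γ) (S : Set V)
    (hS : ∀ a b, a ∈ S → b ∈ S → G.Adj a b → γ s(a, b) + p a - p b ∈ Λ) :
    ∀ {x y : V} (w : G.Walk x y), (∀ z ∈ w.support, z ∈ S) → walkVal γ w + p x - p y ∈ Λ
  | _, _, .nil, _ => by simp [walkVal]
  | x, y, .cons (v := z) hxz w, hw => by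
      have h1 := walk_potential γ Λ p S hS w fun z hz => hw z (by simp [hz])
      have h2 := hS x z (hw x (by simp)) (hw z (by simp)) hxz
      have h3 := Λ.add_mem h1 h2
      simp only [walkVal] at h3
      simp only [walkVal, SimpleGraph.Walk.edges_cons, List.map_cons, List.sum_cons]
      convert h3 using 1
      abel

theorem main_coloring {V : Type u} [Fintype V] {Γ : Type v} [AddCommGroup Γ]
    (G : SimpleGraph V) (γ : Sym2 V → Γ) (A : Set Γ) (Λ : AddSubgroup Γ)
    (hΛ : (Λ : Set Γ) = Aᶜ) (t : ℕ) (hno : ¬ ContainsADCycle G γ A t) :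
    ∃ f : V → Fin (t + 2) × Bool, ∀ i, NoCycleValIn G γ A {v | f v = i} := by
  have hA : ∀ x, x ∉ A ↔ x ∈ Λ := fun x => by
    rw [← SetLike.mem_coe, hΛ, Set.mem_compl_iff]
  obtain ⟨R, hR, hdfs⟩ := exists_dfs G
  let p : V → Γ := fun x => lv γ (R x)
  -- strict ancestors in the same residue class are far away
  have hfar : ∀ a b, a ≠ b → R a <+: R b →
      (R a).length % (t + 2) = (R b).length % (t + 2) →
      (R a).length + (t + 2) ≤ (R b).length := by
    intro a b hab hp hmod
    obtain ⟨la, l, ha, hb⟩ := hR.up hp hab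
    have hlt : (R a).length < (R b).length := by rw [ha, hb]; simp
    obtain ⟨k, hk⟩ := (Nat.modEq_iff_dvd' hlt.le).1 hmod
    have hk0 : k ≠ 0 := by rintro rfl; omega
    have := Nat.le_mul_of_pos_right (t + 2) (Nat.pos_of_ne_zero hk0)
    omega
  let B : V → V → Prop := fun a b => G.Adj a b ∧ R a <+: R b ∧
    (R a).length % (t + 2) = (R b).length % (t + 2) ∧ γ s(a, b) + p a - p b ∉ Λ
  have hnest : ∀ a b c, B a c → B b c → R a <+: R b → a = b := by
    intro a b c hac hbc hp
    by_contra hne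
    have h1 := hfar a b hne hp (hac.2.2.1.trans hbc.2.2.1.symm)
    have h2 := (hA _).1 (hR.two_edges γ hno hac.1 hbc.1 hne hp hbc.2.1 h1)
    have h3 := (hA _).1 (hR.long_edge γ hno hac.1 hac.2.1
      (hfar a c hac.1.ne hac.2.1 hac.2.2.1))
    apply hbc.2.2.2
    convert Λ.sub_mem h2 h3 using 1
    simp only [p]
    abel
  obtain ⟨c, hc⟩ := two_color B (fun x => (R x).length)
    (fun a b h => by
      have := hfar a b h.1.ne h.2.1 h.2.2.1
      show (R a).length < (R b).length
      omega)
    (fun a a' b h h' => by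
      rcases List.prefix_or_prefix_of_prefix h.2.1 h'.2.1 with h2 | h2
      · exact hnest _ _ _ h h' h2
      · exact (hnest _ _ _ h' h h2).symm)
  refine ⟨fun x => (⟨(R x).length % (t + 2), Nat.mod_lt _ (by omega)⟩, c x), ?_⟩
  intro i v w _ hw
  rw [hA]
  have hgood : ∀ a b, G.Adj a b → R a <+: R b → c a = c b →
      (R a).length % (t + 2) = (R b).length % (t + 2) →
      γ s(a, b) + p a - p b ∈ Λ ∧ γ s(a, b) + p b - p a ∈ Λ := by
    intro a b hab hp hcc hmod
    constructor
    · by_contra h2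
      exact hc a b ⟨hab, hp, hmod, h2⟩ hcc
    · have h3 := (hA _).1 (hR.long_edge γ hno hab hp (hfar a b hab.ne hp hmod))
      convert h3 using 1
      simp only [p]
      abel
  have := walk_potential γ Λ p _ (fun a b ha hb hab => by
    have hfe := ha.trans hb.symm
    simp only [Prod.mk.injEq, Fin.mk.injEq] at hfe
    rcases hdfs a b hab with h2 | h2
    · exact (hgood a b hab h2 hfe.2 hfe.1).1
    · rw [Sym2.eq_swap]
      exact (hgood b a hab.symm h2 hfe.2.symm hfe.1.symm).2) w hw
  simpa using this

theorem statement13 :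
    ∃ g : ℕ → ℕ,
      ∀ (Γ : Type v) [AddCommGroup Γ] (A : Set Γ), A.Nonempty →
        (∃ Λ : AddSubgroup Γ, (Λ : Set Γ) = Aᶜ) →
        ∀ (V : Type u) [Fintype V] (G : SimpleGraph V) (γ : Sym2 V → Γ) (t : ℕ),
          g t ≤ arb G γ A →
          ContainsADCycle G γ A t := by
  refine ⟨fun t => (t + 2) * 2 + 1, ?_⟩
  rintro Γ _ A - ⟨Λ, hΛ⟩ V _ G γ t hg
  by_contra hno
  obtain ⟨f, hf⟩ := main_coloring G γ A Λ hΛ t hno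
  have e : Fin (t + 2) × Bool ≃ Fin ((t + 2) * 2) :=
    Fintype.equivFinOfCardEq (by simp)
  have : arb G γ A ≤ (t + 2) * 2 := by
    apply Nat.sInf_le
    refine ⟨fun x => e (f x), fun i v w hw hs => ?_⟩
    refine hf (e.symm i) v w hw fun x hx => ?_
    have := (hs x hx).2
    simp [← this]
  have hg' : (t + 2) * 2 + 1 ≤ arb G γ A := hg
  omega

end ArbPaper
end
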